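/- arXiv:1405.4526 — 6 statements merged into one kernel-verified Lean document; each statement's English description precedes it below -/
import Mathlib

section
/- Let (X0,Y0) ∈ PPS be strongly efficient with all components positive, and for t ≥ 0 let β(t) = max{β ∈ ℝ : (Ω_t X0, Φ_β Y0) ∈ PPS}. Then there exists t0 > 0 such that for every t ∈ (0, t0]: (1) the point (Ω_t X0, Φ_{β(t)} Y0) is weakly efficient, and (2) there exists a supporting hyperplane (V,U,μ0) of PPS with U ≥ 0 and V ≥ 0 componentwise that contains both (X0,Y0) and (Ω_t X0, Φ_{β(t)} Y0) (the hyperplane may depend on t). -/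
open Finset Set

/-- The production possibility set (variable returns to scale):
`(X, Y) ∈ PPS` iff there are convex weights `lam` with
`Σ_j lam_j X_j ≤ X` and `Y ≤ Σ_j lam_j Y_j` componentwise. -/
def PPS {m s n : ℕ} (X : Fin n → Fin m → ℝ) (Y : Fin n → Fin s → ℝ) :
    Set ((Fin m → ℝ) × (Fin s → ℝ)) :=
  {p | ∃ lam : Fin n → ℝ, (∀ j, 0 ≤ lam j) ∧ (∑ j, lam j) = 1 ∧
    (∀ i, ∑ j, lam j * X j i ≤ p.1 i) ∧ (∀ r, p.2 r ≤ ∑ j, lam j * Y j r)}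

/-- Weak efficiency: no point of PPS strictly dominates in every coordinate. -/
def WeaklyEfficient {m s n : ℕ} (X : Fin n → Fin m → ℝ) (Y : Fin n → Fin s → ℝ)
    (p : (Fin m → ℝ) × (Fin s → ℝ)) : Prop :=
  p ∈ PPS X Y ∧ ¬ ∃ q ∈ PPS X Y, (∀ i, q.1 i < p.1 i) ∧ (∀ r, p.2 r < q.2 r)

/-- Strong (Pareto) efficiency. -/
def StronglyEfficient {m s n : ℕ} (X : Fin n → Fin m → ℝ) (Y : Fin n → Fin s → ℝ)
    (p : (Fin m → ℝ) × (Fin s → ℝ)) : Prop :=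
  p ∈ PPS X Y ∧ ¬ ∃ q ∈ PPS X Y, (∀ i, q.1 i ≤ p.1 i) ∧ (∀ r, p.2 r ≤ q.2 r) ∧ q ≠ p

/-- `(V, U, μ0)` is a supporting hyperplane of PPS at the point `p0`. -/
def SupportingHyperplane {m s n : ℕ} (X : Fin n → Fin m → ℝ) (Y : Fin n → Fin s → ℝ)
    (p0 : (Fin m → ℝ) × (Fin s → ℝ)) (V : Fin m → ℝ) (U : Fin s → ℝ) (μ0 : ℝ) : Prop :=
  (¬ (V = 0 ∧ U = 0)) ∧
  ((∑ r, U r * p0.2 r) - (∑ i, V i * p0.1 i) + μ0 = 0) ∧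
  (∀ p ∈ PPS X Y, (∑ r, U r * p.2 r) - (∑ i, V i * p.1 i) + μ0 ≤ 0)

/-- `Ω_t X0 = ((1 + ω_i t) x_{i0})_i`. -/
noncomputable def scaleX {m : ℕ} (ω : Fin m → ℝ) (t : ℝ) (X0 : Fin m → ℝ) : Fin m → ℝ :=
  fun i => (1 + ω i * t) * X0 i

/-- `Φ_β Y0 = ((1 + δ_r β) y_{r0})_r`. -/
noncomputable def scaleY {s : ℕ} (δ : Fin s → ℝ) (β : ℝ) (Y0 : Fin s → ℝ) : Fin s → ℝ :=
  fun r => (1 + δ r * β) * Y0 r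

/-- `(X0, Y0)` is of the directional smallest scale size:
`(Ω_t X0, Φ_β Y0) ∉ PPS` for every `t < 0` and every `β`. -/
def DSSS {m s n : ℕ} (X : Fin n → Fin m → ℝ) (Y : Fin n → Fin s → ℝ)
    (ω : Fin m → ℝ) (δ : Fin s → ℝ) (X0 : Fin m → ℝ) (Y0 : Fin s → ℝ) : Prop :=
  ∀ t < (0 : ℝ), ∀ β : ℝ, (scaleX ω t X0, scaleY δ β Y0) ∉ PPS X Y

/-- Feasible region `F` of the fractional program (Model 28): triples `(U, V, μ0)`. -/
def Fset {m s n : ℕ} (X : Fin n → Fin m → ℝ) (Y : Fin n → Fin s → ℝ)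
    (X0 : Fin m → ℝ) (Y0 : Fin s → ℝ) : Set ((Fin s → ℝ) × (Fin m → ℝ) × ℝ) :=
  {p | (∀ r, 0 ≤ p.1 r) ∧ (∀ i, 0 ≤ p.2.1 i) ∧
    (∀ j, (∑ r, p.1 r * Y j r) - (∑ i, p.2.1 i * X j i) + p.2.2 ≤ 0) ∧
    ((∑ r, p.1 r * Y0 r) - (∑ i, p.2.1 i * X0 i) + p.2.2 = 0) ∧
    ((∑ i, p.2.1 i * X0 i) = 1)}

/-- The fractional objective `(Σ_i v_i ω_i x_{i0}) / (Σ_r u_r δ_r y_{r0})` of Model (28). -/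
noncomputable def seRatio {m s : ℕ} (ω : Fin m → ℝ) (δ : Fin s → ℝ)
    (X0 : Fin m → ℝ) (Y0 : Fin s → ℝ) (p : (Fin s → ℝ) × (Fin m → ℝ) × ℝ) : ℝ :=
  (∑ i, p.2.1 i * ω i * X0 i) / (∑ r, p.1 r * δ r * Y0 r)

/-- Feasible region `G` of the linear program (Model 33): tuples `(Γ, Λ, τ, μ0')`. -/
def Gset {m s n : ℕ} (X : Fin n → Fin m → ℝ) (Y : Fin n → Fin s → ℝ)
    (ω : Fin m → ℝ) (δ : Fin s → ℝ) (X0 : Fin m → ℝ) (Y0 : Fin s → ℝ) :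
    Set ((Fin m → ℝ) × (Fin s → ℝ) × ℝ × ℝ) :=
  {q | (∀ i, 0 ≤ q.1 i) ∧ (∀ r, 0 ≤ q.2.1 r) ∧ 0 ≤ q.2.2.1 ∧
    (∀ j, (∑ r, q.2.1 r / δ r * Y j r) - (∑ i, q.1 i / ω i * X j i) + q.2.2.2 ≤ 0) ∧
    ((∑ r, q.2.1 r / δ r * Y0 r) - (∑ i, q.1 i / ω i * X0 i) + q.2.2.2 = 0) ∧
    ((∑ i, q.1 i / ω i * X0 i) = q.2.2.1) ∧
    ((∑ r, q.2.1 r * Y0 r) = 1)}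

open Filter Topology

/-- The affine functional `U ⬝ Y - V ⬝ X + μ0` evaluated at `p = (X, Y)`. -/
def planeValue {m s : ℕ} (V : Fin m → ℝ) (U : Fin s → ℝ) (μ0 : ℝ)
    (p : (Fin m → ℝ) × (Fin s → ℝ)) : ℝ :=
  (∑ r, U r * p.2 r) - (∑ i, V i * p.1 i) + μ0

section PPS

variable {m s n : ℕ} {X : Fin n → Fin m → ℝ} {Y : Fin n → Fin s → ℝ}

lemma PPS_mono {p q : (Fin m → ℝ) × (Fin s → ℝ)} (hp : p ∈ PPS X Y)
    (h1 : ∀ i, p.1 i ≤ q.1 i) (h2 : ∀ r, q.2 r ≤ p.2 r) : q ∈ PPS X Y := by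
  obtain ⟨l, h0, hs, hx, hy⟩ := hp
  exact ⟨l, h0, hs, fun i => (hx i).trans (h1 i), fun r => (h2 r).trans (hy r)⟩

lemma observed_mem_PPS (j : Fin n) : (X j, Y j) ∈ PPS X Y := by
  classical
  refine ⟨fun k => if k = j then 1 else 0, fun k => ?_, ?_, fun i => ?_, fun r => ?_⟩
  · dsimp only
    split_ifs <;> norm_num
  all_goals simp

lemma convex_PPS : Convex ℝ (PPS X Y) := by
  rintro p ⟨l, hl0, hl1, hlx, hly⟩ q ⟨k, hk0, hk1, hkx, hky⟩ a b ha hb hab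
  have hcomb : ∀ f : Fin n → ℝ, ∑ j, (a * l j + b * k j) * f j =
      a * ∑ j, l j * f j + b * ∑ j, k j * f j := fun f => by
    simp only [add_mul, Finset.sum_add_distrib, Finset.mul_sum, mul_assoc]
  refine ⟨fun j => a * l j + b * k j, fun j => ?_, ?_, fun i => ?_, fun r => ?_⟩
  · have := hl0 j
    have := hk0 j
    positivity
  · rw [Finset.sum_add_distrib, ← Finset.mul_sum, ← Finset.mul_sum, hl1, hk1]
    linarith
  · rw [hcomb]
    exact add_le_add (mul_le_mul_of_nonneg_left (hlx i) ha)
      (mul_le_mul_of_nonneg_left (hkx i) hb)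
  · rw [hcomb]
    exact add_le_add (mul_le_mul_of_nonneg_left (hly r) ha)
      (mul_le_mul_of_nonneg_left (hky r) hb)

lemma isClosed_PPS : IsClosed (PPS X Y) := by
  have : CompactSpace (stdSimplex ℝ (Fin n)) :=
    isCompact_iff_compactSpace.mp (isCompact_stdSimplex ℝ (Fin n))
  let C : Set (stdSimplex ℝ (Fin n) × ((Fin m → ℝ) × (Fin s → ℝ))) :=
    {z | (∀ i, ∑ j, z.1.1 j * X j i ≤ z.2.1 i) ∧ (∀ r, z.2.2 r ≤ ∑ j, z.1.1 j * Y j r)}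
  have hl : ∀ j, Continuous
      fun z : stdSimplex ℝ (Fin n) × ((Fin m → ℝ) × (Fin s → ℝ)) => z.1.1 j := fun j =>
    (continuous_apply j).comp (continuous_subtype_val.comp continuous_fst)
  have hC : IsClosed C := by
    refine IsClosed.and ?_ ?_
    · simp only [Set.ofPred_forall]
      exact isClosed_iInter fun i => isClosed_le
        (continuous_finsetSum _ fun j _ => (hl j).mul continuous_const) (by fun_prop)
    · simp only [Set.ofPred_forall]
      exact isClosed_iInter fun r => isClosed_le (by fun_prop)
        (continuous_finsetSum _ fun j _ => (hl j).mul continuous_const)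
  have himage : Set.image Prod.snd C = PPS X Y := by
    ext p
    constructor
    · rintro ⟨⟨l, q⟩, ⟨hx, hy⟩, rfl⟩
      exact ⟨l.1, l.2.1, l.2.2, hx, hy⟩
    · rintro ⟨l, h0, h1, hx, hy⟩
      exact ⟨(⟨l, h0, h1⟩, p), ⟨hx, hy⟩, rfl⟩
  rw [← himage]
  exact isClosedMap_snd_of_compactSpace _ hC

/-- A linear functional on input-output pairs is given by its values on the unit vectors. -/
lemma linear_functional_apply (f : ((Fin m → ℝ) × (Fin s → ℝ)) →L[ℝ] ℝ)
    (p : (Fin m → ℝ) × (Fin s → ℝ)) :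
    f p = ∑ i, f (Pi.single i 1, 0) * p.1 i + ∑ r, f (0, Pi.single r 1) * p.2 r := by
  have h1 := LinearMap.pi_apply_eq_sum_univ
    (f.toLinearMap.comp (LinearMap.inl ℝ (Fin m → ℝ) (Fin s → ℝ))) p.1
  have h2 := LinearMap.pi_apply_eq_sum_univ
    (f.toLinearMap.comp (LinearMap.inr ℝ (Fin m → ℝ) (Fin s → ℝ))) p.2
  have hsplit : f p = f (p.1, 0) + f (0, p.2) := by
    rw [← map_add]
    simp
  have hs1 : ∀ i : Fin m, (fun j => if i = j then (1 : ℝ) else 0) = Pi.single i 1 := fun i => by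
    ext j
    simp [Pi.single_apply, eq_comm]
  have hs2 : ∀ i : Fin s, (fun j => if i = j then (1 : ℝ) else 0) = Pi.single i 1 := fun i => by
    ext j
    simp [Pi.single_apply, eq_comm]
  simp only [LinearMap.coe_comp, Function.comp_apply, LinearMap.inl_apply, LinearMap.inr_apply,
    ContinuousLinearMap.coe_coe, smul_eq_mul, hs1, hs2] at h1 h2
  rw [hsplit, h1, h2]
  simp only [mul_comm]

lemma WeaklyEfficient.exists_supportingHyperplane {p : (Fin m → ℝ) × (Fin s → ℝ)}
    (hp : WeaklyEfficient X Y p) :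
    ∃ V : Fin m → ℝ, ∃ U : Fin s → ℝ, ∃ μ0 : ℝ,
      (∀ i, 0 ≤ V i) ∧ (∀ r, 0 ≤ U r) ∧ SupportingHyperplane X Y p V U μ0 := by
  obtain ⟨hmem, hdom⟩ := hp
  let D : Set ((Fin m → ℝ) × (Fin s → ℝ)) :=
    (Set.univ.pi fun i => Set.Iio (p.1 i)) ×ˢ (Set.univ.pi fun r => Set.Ioi (p.2 r))
  have hDconv : Convex ℝ D :=
    (convex_pi fun i _ => convex_Iio _).prod (convex_pi fun r _ => convex_Ioi _)
  have hDopen : IsOpen D :=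
    (isOpen_set_pi Set.finite_univ fun i _ => isOpen_Iio).prod
      (isOpen_set_pi Set.finite_univ fun r _ => isOpen_Ioi)
  have hdisj : Disjoint D (PPS X Y) := by
    rw [Set.disjoint_left]
    rintro q ⟨hq1, hq2⟩ hq
    exact hdom ⟨q, hq, fun i => hq1 i trivial, fun r => hq2 r trivial⟩
  obtain ⟨f, u, hfD, hfP⟩ := geometric_hahn_banach_open hDconv hDopen convex_PPS hdisj
  have hshift : ∀ ε : ℝ, 0 < ε → f p + ε * f (-1, 1) < u := by
    intro ε hε
    have h := hfD (p + ε • ((-1 : Fin m → ℝ), (1 : Fin s → ℝ)))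
      ⟨fun i _ => by simp [hε], fun r _ => by simp [hε]⟩
    rwa [map_add, map_smul, smul_eq_mul] at h
  have hfp : f p = u := by
    refine le_antisymm ?_ (hfP p hmem)
    have ht : Tendsto (fun ε : ℝ => f p + ε * f (-1, 1)) (𝓝[>] 0) (𝓝 (f p)) := by
      have hc : Continuous fun ε : ℝ => f p + ε * f (-1, 1) := by fun_prop
      have h0 := hc.tendsto 0
      simp only [zero_mul, add_zero] at h0
      exact h0.mono_left nhdsWithin_le_nhds
    exact le_of_tendsto ht (eventually_nhdsWithin_of_forall fun ε hε => (hshift ε hε).le)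
  have hV : ∀ i, 0 ≤ f (Pi.single i 1, 0) := by
    intro i
    have hnn : (0 : Fin m → ℝ) ≤ Pi.single i 1 := Pi.single_nonneg.mpr zero_le_one
    have h := hfP (p + (Pi.single i 1, 0)) (PPS_mono hmem
      (fun k => by simpa using hnn k) (fun r => by simp))
    rw [map_add] at h
    linarith
  have hU : ∀ r, f (0, Pi.single r 1) ≤ 0 := by
    intro r
    have hnn : (0 : Fin s → ℝ) ≤ Pi.single r 1 := Pi.single_nonneg.mpr zero_le_one
    have h := hfP (p - (0, Pi.single r 1)) (PPS_mono hmem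
      (fun k => by simp) (fun k => by simpa using hnn k))
    rw [map_sub] at h
    linarith
  have hval : ∀ q : (Fin m → ℝ) × (Fin s → ℝ),
      (∑ r, -f (0, Pi.single r 1) * q.2 r) - (∑ i, f (Pi.single i 1, 0) * q.1 i) + u =
        u - f q := by
    intro q
    rw [linear_functional_apply f q]
    simp only [neg_mul, Finset.sum_neg_distrib]
    ring
  refine ⟨fun i => f (Pi.single i 1, 0), fun r => -f (0, Pi.single r 1), u, hV,
    fun r => neg_nonneg.mpr (hU r), ?_, ?_, ?_⟩
  · rintro ⟨hV0, hU0⟩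
    have hzero : f (-1, 1) = 0 := by
      rw [linear_functional_apply f]
      have h1 : ∀ i, f (Pi.single i 1, 0) = 0 := fun i => congrFun hV0 i
      have h2 : ∀ r, f (0, Pi.single r 1) = 0 := fun r => neg_eq_zero.mp (congrFun hU0 r)
      simp [h1, h2]
    have h := hshift 1 one_pos
    rw [hzero, hfp] at h
    linarith
  · rw [hval, hfp, sub_self]
  · intro q hq
    rw [hval]
    linarith [hfP q hq]

/-- A point of PPS on a nonnegative supporting hyperplane lies on every hyperplane that is
tight at all the observations and coordinates where the first one is. -/
lemma planeValue_eq_zero_of_tight {p : (Fin m → ℝ) × (Fin s → ℝ)} (hp : p ∈ PPS X Y)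
    {V V' : Fin m → ℝ} {U U' : Fin s → ℝ} {μ0 μ0' : ℝ}
    (hV : ∀ i, 0 ≤ V i) (hU : ∀ r, 0 ≤ U r)
    (hle : ∀ j, planeValue V U μ0 (X j, Y j) ≤ 0) (hzero : planeValue V U μ0 p = 0)
    (htight : ∀ j, planeValue V U μ0 (X j, Y j) = 0 → planeValue V' U' μ0' (X j, Y j) = 0)
    (hV' : ∀ i, V i = 0 → V' i = 0) (hU' : ∀ r, U r = 0 → U' r = 0) :
    planeValue V' U' μ0' p = 0 := by
  obtain ⟨l, hl0, hl1, hx, hy⟩ := hp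
  have hdecomp : ∀ (A : Fin m → ℝ) (B : Fin s → ℝ) (c : ℝ), planeValue A B c p =
      (∑ j, l j * planeValue A B c (X j, Y j)) - (∑ i, A i * (p.1 i - ∑ j, l j * X j i)) -
        ∑ r, B r * ((∑ j, l j * Y j r) - p.2 r) := by
    intro A B c
    have h1 : ∑ j, l j * ∑ r, B r * Y j r = ∑ r, B r * ∑ j, l j * Y j r := by
      simp only [Finset.mul_sum]
      rw [Finset.sum_comm]
      exact Finset.sum_congr rfl fun _ _ => Finset.sum_congr rfl fun _ _ => by ring
    have h2 : ∑ j, l j * ∑ i, A i * X j i = ∑ i, A i * ∑ j, l j * X j i := by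
      simp only [Finset.mul_sum]
      rw [Finset.sum_comm]
      exact Finset.sum_congr rfl fun _ _ => Finset.sum_congr rfl fun _ _ => by ring
    simp only [planeValue, mul_sub, mul_add, Finset.sum_add_distrib, Finset.sum_sub_distrib,
      h1, h2, ← Finset.sum_mul, hl1]
    ring
  have hA : ∀ j ∈ Finset.univ, l j * planeValue V U μ0 (X j, Y j) ≤ 0 :=
    fun j _ => mul_nonpos_of_nonneg_of_nonpos (hl0 j) (hle j)
  have hB : ∀ i ∈ Finset.univ, 0 ≤ V i * (p.1 i - ∑ j, l j * X j i) :=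
    fun i _ => mul_nonneg (hV i) (sub_nonneg.mpr (hx i))
  have hC : ∀ r ∈ Finset.univ, 0 ≤ U r * ((∑ j, l j * Y j r) - p.2 r) :=
    fun r _ => mul_nonneg (hU r) (sub_nonneg.mpr (hy r))
  have hA' := Finset.sum_nonpos hA
  have hB' := Finset.sum_nonneg hB
  have hC' := Finset.sum_nonneg hC
  rw [hdecomp] at hzero
  have hA0 := (Finset.sum_eq_zero_iff_of_nonpos hA).mp (by linarith)
  have hB0 := (Finset.sum_eq_zero_iff_of_nonneg hB).mp (by linarith)
  have hC0 := (Finset.sum_eq_zero_iff_of_nonneg hC).mp (by linarith)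
  rw [hdecomp, Finset.sum_eq_zero, Finset.sum_eq_zero, Finset.sum_eq_zero]
  · norm_num
  · intro r hr
    rcases mul_eq_zero.mp (hC0 r hr) with h | h
    · rw [hU' r h, zero_mul]
    · rw [h, mul_zero]
  · intro i hi
    rcases mul_eq_zero.mp (hB0 i hi) with h | h
    · rw [hV' i h, zero_mul]
    · rw [h, mul_zero]
  · intro j hj
    rcases mul_eq_zero.mp (hA0 j hj) with h | h
    · rw [h, zero_mul]
    · rw [htight j h, mul_zero]

lemma weaklyEfficient_of_isGreatest {δ : Fin s → ℝ} {x : Fin m → ℝ} {Y0 : Fin s → ℝ} {β : ℝ}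
    (hβ : IsGreatest {β : ℝ | (x, scaleY δ β Y0) ∈ PPS X Y} β) :
    WeaklyEfficient X Y (x, scaleY δ β Y0) := by
  refine ⟨hβ.1, ?_⟩
  rintro ⟨q, hq, hq1, hq2⟩
  have hnear : ∀ᶠ b in 𝓝[>] β, ∀ r, scaleY δ b Y0 r < q.2 r := by
    refine eventually_all.mpr fun r => nhdsWithin_le_nhds ?_
    have hc : Continuous fun b => scaleY δ b Y0 r := by
      unfold scaleY
      fun_prop
    exact hc.continuousAt.eventually_lt_const (hq2 r)
  obtain ⟨b, hb, hβb⟩ := (hnear.and self_mem_nhdsWithin).exists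
  have hbmem : (x, scaleY δ b Y0) ∈ PPS X Y :=
    PPS_mono hq (fun i => (hq1 i).le) (fun r => (hb r).le)
  exact absurd (hβ.2 hbmem) (not_le.mpr hβb)

lemma planeValue_scale (V : Fin m → ℝ) (U : Fin s → ℝ) (μ0 : ℝ) (ω : Fin m → ℝ) (δ : Fin s → ℝ)
    (X0 : Fin m → ℝ) (Y0 : Fin s → ℝ) (t β : ℝ) :
    planeValue V U μ0 (scaleX ω t X0, scaleY δ β Y0) =
      planeValue V U μ0 (X0, Y0) - (∑ i, V i * (ω i * X0 i)) * t +
        (∑ r, U r * (δ r * Y0 r)) * β := by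
  have h1 : ∑ i, V i * scaleX ω t X0 i = ∑ i, V i * X0 i + (∑ i, V i * (ω i * X0 i)) * t := by
    rw [Finset.sum_mul, ← Finset.sum_add_distrib]
    exact Finset.sum_congr rfl fun i _ => by unfold scaleX; ring
  have h2 : ∑ r, U r * scaleY δ β Y0 r = ∑ r, U r * Y0 r + (∑ r, U r * (δ r * Y0 r)) * β := by
    rw [Finset.sum_mul, ← Finset.sum_add_distrib]
    exact Finset.sum_congr rfl fun r _ => by unfold scaleY; ring
  simp only [planeValue, h1, h2]
  ring

/-- The maximal output expansion tends to `0` as the input expansion does. -/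
lemma tendsto_maximal_expansion {ω : Fin m → ℝ} {δ : Fin s → ℝ} (hω : ∀ i, 0 ≤ ω i)
    (hδ : ∀ r, 0 ≤ δ r) (hδpos : ∃ r, 0 < δ r) {X0 : Fin m → ℝ} {Y0 : Fin s → ℝ}
    (hX0 : ∀ i, 0 < X0 i) (hY0 : ∀ r, 0 < Y0 r) (hse : StronglyEfficient X Y (X0, Y0))
    {βf : ℝ → ℝ} (hβf : ∀ t : ℝ, 0 ≤ t →
      IsGreatest {β : ℝ | (scaleX ω t X0, scaleY δ β Y0) ∈ PPS X Y} (βf t)) :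
    Tendsto βf (𝓝[>] 0) (𝓝 0) := by
  have hnonneg : ∀ t : ℝ, 0 ≤ t → 0 ≤ βf t := fun t ht => (hβf t ht).2 <|
    PPS_mono hse.1 (fun i => by
      have := mul_nonneg (mul_nonneg (hω i) ht) (hX0 i).le
      simp only [scaleX]
      linarith) (fun r => by simp [scaleY])
  refine tendsto_order.mpr ⟨fun a ha => ?_, fun ε hε => ?_⟩
  · exact eventually_nhdsWithin_of_forall fun t ht => ha.trans_le (hnonneg t (le_of_lt ht))
  · by_contra hnot
    have hfreq : ∃ᶠ t in 𝓝[>] (0 : ℝ), (scaleX ω t X0, scaleY δ ε Y0) ∈ PPS X Y := by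
      refine ((not_eventually.mp hnot).and_eventually self_mem_nhdsWithin).mono ?_
      rintro t ⟨hlt, ht⟩
      exact PPS_mono (hβf t (le_of_lt ht)).1 (fun i => le_rfl) fun r =>
        mul_le_mul_of_nonneg_right
          (add_le_add_right (mul_le_mul_of_nonneg_left (not_lt.mp hlt) (hδ r)) 1) (hY0 r).le
    have hc : Continuous fun t => (scaleX ω t X0, scaleY δ ε Y0) := by
      unfold scaleX
      fun_prop
    have hlim := (hc.tendsto 0).mono_left (nhdsWithin_le_nhds (s := Set.Ioi 0))
    have hmem := isClosed_PPS.mem_of_frequently_of_tendsto hfreq hlim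
    have hx0 : scaleX ω 0 X0 = X0 := by
      ext i
      simp [scaleX]
    rw [hx0] at hmem
    refine hse.2 ⟨_, hmem, fun i => le_rfl, fun r => ?_, fun heq => ?_⟩
    · have := mul_nonneg (mul_nonneg (hδ r) hε.le) (hY0 r).le
      simp only [scaleY]
      linarith
    · obtain ⟨r, hr⟩ := hδpos
      have h := congrFun (congrArg Prod.snd heq) r
      have := mul_pos (mul_pos hr hε) (hY0 r)
      simp only [scaleY] at h
      linarith

/-- The maximal output expansion over `[0, t1]` lies above its chord from the origin. -/
lemma chord_le_maximal_expansion {ω : Fin m → ℝ} {δ : Fin s → ℝ} {X0 : Fin m → ℝ}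
    {Y0 : Fin s → ℝ} (h0 : (X0, Y0) ∈ PPS X Y) {t t1 β β1 : ℝ} (ht : 0 < t) (htt : t ≤ t1)
    (h1 : (scaleX ω t1 X0, scaleY δ β1 Y0) ∈ PPS X Y)
    (hβ : IsGreatest {β : ℝ | (scaleX ω t X0, scaleY δ β Y0) ∈ PPS X Y} β) :
    t / t1 * β1 ≤ β := by
  have ht1 : 0 < t1 := ht.trans_le htt
  have hcomb := convex_PPS h0 h1 (sub_nonneg.mpr ((div_le_one ht1).mpr htt))
    (div_pos ht ht1).le (sub_add_cancel 1 (t / t1))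
  refine hβ.2 (PPS_mono hcomb (fun i => le_of_eq ?_) (fun r => le_of_eq ?_))
  · simp only [scaleX, Prod.fst_add, Prod.smul_fst, Pi.add_apply, Pi.smul_apply, smul_eq_mul]
    field_simp
    ring
  · simp only [scaleY, Prod.snd_add, Prod.smul_snd, Pi.add_apply, Pi.smul_apply, smul_eq_mul]
    ring

end PPS

/-- Theorem 1 (right-hand): for all small enough t > 0, the maximizer point
(Ω_t X0, Φ_{β(t)} Y0) is weakly efficient and shares a (nonnegative) supporting
hyperplane of PPS with (X0, Y0). -/
theorem right_hand_weak_efficiency_and_common_supporting_hyperplane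
    {m s n : ℕ} (hm : 1 ≤ m) (hs : 1 ≤ s) (hn : 1 ≤ n)
    (X : Fin n → Fin m → ℝ) (Y : Fin n → Fin s → ℝ)
    (hX : ∀ j i, 0 < X j i) (hY : ∀ j r, 0 < Y j r)
    (ω : Fin m → ℝ) (δ : Fin s → ℝ)
    (hω : ∀ i, 0 ≤ ω i) (hδ : ∀ r, 0 ≤ δ r)
    (hωsum : (∑ i, ω i) = (m : ℝ)) (hδsum : (∑ r, δ r) = (s : ℝ))
    (X0 : Fin m → ℝ) (Y0 : Fin s → ℝ)
    (hX0 : ∀ i, 0 < X0 i) (hY0 : ∀ r, 0 < Y0 r)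
    (hse : StronglyEfficient X Y (X0, Y0))
    (βf : ℝ → ℝ)
    (hβf : ∀ t : ℝ, 0 ≤ t →
      IsGreatest {β : ℝ | (scaleX ω t X0, scaleY δ β Y0) ∈ PPS X Y} (βf t)) :
    ∃ t0 > (0 : ℝ), ∀ t ∈ Set.Ioc (0 : ℝ) t0,
      WeaklyEfficient X Y (scaleX ω t X0, scaleY δ (βf t) Y0) ∧
      ∃ V : Fin m → ℝ, ∃ U : Fin s → ℝ, ∃ μ0 : ℝ,
        (∀ i, 0 ≤ V i) ∧ (∀ r, 0 ≤ U r) ∧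
        SupportingHyperplane X Y (X0, Y0) V U μ0 ∧
        (∑ r, U r * scaleY δ (βf t) Y0 r) - (∑ i, V i * scaleX ω t X0 i) + μ0 = 0 := by
  have hδpos : ∃ r, 0 < δ r := by
    by_contra! hnone
    have hsum : ∑ r, δ r ≤ 0 := Finset.sum_nonpos fun r _ => hnone r
    have hs' : (1 : ℝ) ≤ s := by exact_mod_cast hs
    linarith
  have hweak : ∀ t : ℝ, 0 ≤ t → WeaklyEfficient X Y (scaleX ω t X0, scaleY δ (βf t) Y0) :=
    fun t ht => weaklyEfficient_of_isGreatest (hβf t ht)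
  have hplane : ∀ t : ℝ, ∃ V : Fin m → ℝ, ∃ U : Fin s → ℝ, ∃ μ0 : ℝ, 0 ≤ t →
      (∀ i, 0 ≤ V i) ∧ (∀ r, 0 ≤ U r) ∧
        SupportingHyperplane X Y (scaleX ω t X0, scaleY δ (βf t) Y0) V U μ0 := by
    intro t
    by_cases ht : 0 ≤ t
    · obtain ⟨V, U, μ0, h⟩ := (hweak t ht).exists_supportingHyperplane
      exact ⟨V, U, μ0, fun _ => h⟩
    · exact ⟨0, 0, 0, fun h => absurd h ht⟩
  choose V U μ0 hVU using hplane
  let tight : ℝ → Set (Fin n) × Set (Fin m) × Set (Fin s) := fun t =>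
    ({j | planeValue (V t) (U t) (μ0 t) (X j, Y j) = 0}, {i | V t i = 0}, {r | U t r = 0})
  obtain ⟨S, hS⟩ : ∃ S, ∃ᶠ t in 𝓝[>] (0 : ℝ), tight t = S := by
    by_contra! hnone
    have hall : ∀ᶠ t in 𝓝[>] (0 : ℝ), ∀ S, tight t ≠ S :=
      eventually_all.mpr hnone
    obtain ⟨t, ht⟩ := hall.exists
    exact ht _ rfl
  obtain ⟨t1, hS1, ht1⟩ := (hS.and_eventually self_mem_nhdsWithin).exists
  replace ht1 : 0 < t1 := ht1
  obtain ⟨hV1, hU1, hne, hon, hbelow⟩ := hVU t1 ht1.le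
  have hfreq : ∃ᶠ t in 𝓝[>] (0 : ℝ),
      planeValue (V t1) (U t1) (μ0 t1) (scaleX ω t X0, scaleY δ (βf t) Y0) ∈ ({0} : Set ℝ) := by
    refine (hS.and_eventually self_mem_nhdsWithin).mono ?_
    rintro t ⟨hSt, ht⟩
    replace ht : 0 < t := ht
    obtain ⟨hVt, hUt, -, hont, hbelowt⟩ := hVU t ht.le
    have heq : tight t = tight t1 := hSt.trans hS1.symm
    have hj := congrArg Prod.fst heq
    have hi := congrArg (fun z => z.2.1) heq
    have hr := congrArg (fun z => z.2.2) heq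
    exact planeValue_eq_zero_of_tight (hβf t ht.le).1 hVt hUt
      (fun j => hbelowt _ (observed_mem_PPS j)) hont
      (fun j h => (Set.ext_iff.mp hj j).mp h) (fun i h => (Set.ext_iff.mp hi i).mp h)
      (fun r h => (Set.ext_iff.mp hr r).mp h)
  have hβ0 := tendsto_maximal_expansion hω hδ hδpos hX0 hY0 hse hβf
  have hlim : Tendsto (fun t => planeValue (V t1) (U t1) (μ0 t1)
      (scaleX ω t X0, scaleY δ (βf t) Y0)) (𝓝[>] 0)
      (𝓝 (planeValue (V t1) (U t1) (μ0 t1) (X0, Y0))) := by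
    simp only [planeValue_scale]
    have hid : Tendsto (fun t : ℝ => t) (𝓝[>] 0) (𝓝 0) := nhdsWithin_le_nhds
    simpa using (tendsto_const_nhds.sub (hid.const_mul _)).add (hβ0.const_mul _)
  have hon0 : planeValue (V t1) (U t1) (μ0 t1) (X0, Y0) = 0 :=
    isClosed_singleton.mem_of_frequently_of_tendsto hfreq hlim
  refine ⟨t1, ht1, fun t ht => ⟨hweak t ht.1.le, V t1, U t1, μ0 t1, hV1, hU1,
    ⟨hne, hon0, hbelow⟩, le_antisymm (hbelow _ (hβf t ht.1.le).1) ?_⟩⟩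
  change 0 ≤ planeValue (V t1) (U t1) (μ0 t1) (scaleX ω t X0, scaleY δ (βf t) Y0)
  change planeValue (V t1) (U t1) (μ0 t1) (scaleX ω t1 X0, scaleY δ (βf t1) Y0) = 0 at hon
  rw [planeValue_scale, hon0] at hon ⊢
  have hchord := chord_le_maximal_expansion hse.1 ht.1 ht.2 (hβf t1 ht1.le).1 (hβf t ht.1.le)
  have hb : 0 ≤ ∑ r, U t1 r * (δ r * Y0 r) :=
    Finset.sum_nonneg fun r _ => mul_nonneg (hU1 r) (mul_nonneg (hδ r) (hY0 r).le)
  have hscaled : 0 - (∑ i, V t1 i * (ω i * X0 i)) * t +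
      (∑ r, U t1 r * (δ r * Y0 r)) * (t / t1 * βf t1) = 0 := by
    calc _ = t / t1 * (0 - (∑ i, V t1 i * (ω i * X0 i)) * t1 +
          (∑ r, U t1 r * (δ r * Y0 r)) * βf t1) := by
          field_simp
          ring
      _ = 0 := by rw [hon, mul_zero]
  linarith [mul_le_mul_of_nonneg_left hchord hb]
end

section
/- Let (X0,Y0) ∈ PPS be strongly efficient with all components positive and suppose (X0,Y0) is not of the directional smallest scale size. For t > 0 small enough that the set {β ∈ ℝ : (Ω_{−t} X0, Φ_{−β} Y0) ∈ PPS} is nonempty, let β₋(t) be its minimum. Then there exists t0 > 0 such that the ratio β₋(t)/t is constant for all t ∈ (0, t0]. -/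
open Finset Set

/-- A linear function without a descent direction in the recession cone attains its minimum on
a nonempty polyhedron. -/
theorem exists_isMinOn_polyhedron {V ι : Type*} [AddCommGroup V] [Module ℝ V] [Fintype ι]
    (g : ι → V →ₗ[ℝ] ℝ) (b : ι → ℝ) (f : V →ₗ[ℝ] ℝ)
    (hne : ∃ x, ∀ i, g i x ≤ b i)
    (hrec : ∀ d, (∀ i, g i d ≤ 0) → 0 ≤ f d) :
    ∃ x, (∀ i, g i x ≤ b i) ∧ ∀ y, (∀ i, g i y ≤ b i) → f x ≤ f y := by
  classical
  let active : V → Finset ι := fun x => Finset.univ.filter fun i => g i x = b i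
  let good : Set V := {x | (∀ i, g i x ≤ b i) ∧
    ∀ z, (∀ i, g i z ≤ b i) → f z ≤ f x → (active z).card ≤ (active x).card}
  have exists_good : ∀ x, (∀ i, g i x ≤ b i) → ∃ y ∈ good, f y ≤ f x := by
    intro x hx
    let N : Set ℕ := {k | ∃ y, (∀ i, g i y ≤ b i) ∧ f y ≤ f x ∧ (active y).card = k}
    have hN : N.Finite := (Set.finite_le_nat (Fintype.card ι)).subset (by
      rintro k ⟨y, -, -, rfl⟩
      exact Finset.card_le_univ _)
    obtain ⟨k, ⟨y, hy, hyx, rfl⟩, hmax⟩ :=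
      Set.exists_max_image N id hN ⟨_, x, hx, le_rfl, rfl⟩
    exact ⟨y, ⟨hy, fun z hz hzy => hmax _ ⟨z, hz, hzy.trans hyx, rfl⟩⟩, hyx⟩
  have not_lt_of_active_eq : ∀ x ∈ good, ∀ y ∈ good, active x = active y → ¬ f x < f y := by
    intro x hx y hy hxy hlt
    have hd : ∃ i, 0 < g i (x - y) := by
      by_contra! h
      have := hrec _ h
      rw [map_sub] at this
      linarith
    obtain ⟨i₁, hi₁⟩ := hd
    obtain ⟨i₀, hi₀, hmin⟩ := Finset.exists_min_image
      (Finset.univ.filter fun i => 0 < g i (x - y)) (fun i => (b i - g i x) / g i (x - y))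
      ⟨i₁, by simpa using hi₁⟩
    replace hi₀ : 0 < g i₀ (x - y) := (Finset.mem_filter.1 hi₀).2
    set τ := (b i₀ - g i₀ x) / g i₀ (x - y) with hτ
    have hτ0 : 0 ≤ τ := div_nonneg (sub_nonneg.2 (hx.1 i₀)) hi₀.le
    have hz : ∀ i, g i (x + τ • (x - y)) ≤ b i := by
      intro i
      rw [map_add, map_smul, smul_eq_mul]
      rcases le_or_gt (g i (x - y)) 0 with h | h
      · have := hx.1 i
        have := mul_nonpos_of_nonneg_of_nonpos hτ0 h
        linarith
      · have := (le_div_iff₀ h).1 (hmin i (by simpa using h))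
        linarith
    have hfz : f (x + τ • (x - y)) ≤ f x := by
      rw [map_add, map_smul, smul_eq_mul, map_sub]
      have := mul_nonpos_of_nonneg_of_nonpos hτ0 (sub_neg.2 hlt).le
      linarith
    have active_eq : ∀ i ∈ active x, g i (x - y) = 0 := by
      intro i hi
      have h₁ : g i x = b i := (Finset.mem_filter.1 hi).2
      have h₂ : g i y = b i := (Finset.mem_filter.1 (show i ∈ active y from hxy ▸ hi)).2
      rw [map_sub, h₁, h₂, sub_self]
    refine absurd (hx.2 _ hz hfz) (not_le.2 (Finset.card_lt_card ?_))
    refine (Finset.ssubset_iff_of_subset ?_).2 ⟨i₀, ?_, fun h => hi₀.ne' (active_eq i₀ h)⟩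
    · intro i hi
      have h₁ : g i x = b i := (Finset.mem_filter.1 hi).2
      simp [active, active_eq i hi, h₁, -map_sub]
    · have : τ * g i₀ (x - y) = b i₀ - g i₀ x := div_mul_cancel₀ _ hi₀.ne'
      simp only [active, Finset.mem_filter, Finset.mem_univ, true_and]
      rw [map_add, map_smul, smul_eq_mul, this]
      ring
  have hfin : (f '' good).Finite := by
    refine (Set.finite_range fun I : Finset ι =>
      if h : ∃ x ∈ good, active x = I then f h.choose else 0).subset ?_
    rintro _ ⟨x, hx, rfl⟩
    have h : ∃ y ∈ good, active y = active x := ⟨x, hx, rfl⟩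
    refine ⟨active x, ?_⟩
    simp only [dif_pos h]
    exact le_antisymm
      (le_of_not_gt (not_lt_of_active_eq x hx _ h.choose_spec.1 h.choose_spec.2.symm))
      (le_of_not_gt (not_lt_of_active_eq _ h.choose_spec.1 x hx h.choose_spec.2))
  obtain ⟨x₀, hx₀⟩ := hne
  obtain ⟨y₀, hy₀, -⟩ := exists_good x₀ hx₀
  obtain ⟨_, ⟨x, hx, rfl⟩, hmin⟩ := Set.exists_min_image (f '' good) id hfin ⟨_, y₀, hy₀, rfl⟩
  refine ⟨x, hx.1, fun y hy => ?_⟩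
  obtain ⟨z, hz, hzy⟩ := exists_good y hy
  exact (hmin _ ⟨z, hz, rfl⟩).trans hzy

/-- Small steps along `μ` from `lam ≥ 0` stay nonnegative if `μ` is nonnegative wherever
`lam` vanishes. -/
theorem exists_pos_forall_nonneg_add_mul {ι : Type*} [Finite ι] {lam μ : ι → ℝ}
    (hlam : ∀ j, 0 ≤ lam j) (hμ : ∀ j, lam j = 0 → 0 ≤ μ j) :
    ∃ t₀ > (0 : ℝ), ∀ t ∈ Set.Ioc 0 t₀, ∀ j, 0 ≤ lam j + t * μ j := by
  have h : ∀ᶠ t in nhdsWithin (0 : ℝ) (Set.Ioi 0), ∀ j, 0 ≤ lam j + t * μ j := by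
    rw [Filter.eventually_all]
    intro j
    rcases (hlam j).eq_or_lt with h0 | h0
    · filter_upwards [self_mem_nhdsWithin] with t ht
      rw [← h0, zero_add]
      exact mul_nonneg (le_of_lt ht) (hμ j h0.symm)
    · have hc : Filter.Tendsto (fun t : ℝ => lam j + t * μ j) (nhds 0) (nhds (lam j)) := by
        have : Continuous fun t : ℝ => lam j + t * μ j := by fun_prop
        simpa using this.tendsto 0
      filter_upwards [nhdsWithin_le_nhds (hc.eventually (lt_mem_nhds h0))] with t ht
      exact ht.le
  obtain ⟨t₀, ht₀, hsub⟩ := mem_nhdsGT_iff_exists_Ioc_subset.1 h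
  exact ⟨t₀, ht₀, fun t ht => hsub ht⟩

/-- The weights representing a strongly efficient point reproduce it without slack. -/
theorem StronglyEfficient.exists_weights {m s n : ℕ} {X : Fin n → Fin m → ℝ}
    {Y : Fin n → Fin s → ℝ} {X0 : Fin m → ℝ} {Y0 : Fin s → ℝ}
    (h : StronglyEfficient X Y (X0, Y0)) :
    ∃ lam : Fin n → ℝ, (∀ j, 0 ≤ lam j) ∧ (∑ j, lam j) = 1 ∧
      (∀ i, ∑ j, lam j * X j i = X0 i) ∧ (∀ r, ∑ j, lam j * Y j r = Y0 r) := by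
  obtain ⟨⟨lam, h0, h1, hx, hy⟩, hdom⟩ := h
  have heq : ((fun i => ∑ j, lam j * X j i, fun r => ∑ j, lam j * Y j r) :
      (Fin m → ℝ) × (Fin s → ℝ)) = (X0, Y0) := by
    by_contra hne
    exact hdom ⟨_, ⟨lam, h0, h1, fun i => le_rfl, fun r => le_rfl⟩, hx, hy, hne⟩
  rw [Prod.mk.injEq] at heq
  exact ⟨lam, h0, h1, congrFun heq.1, congrFun heq.2⟩

/-- Feasible directions `(t, β, μ)` at the weights `lam`, with `t` a rate of input reduction
and `β` a rate of output reduction. -/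
def FeasibleDirection {m s n : ℕ} (X : Fin n → Fin m → ℝ) (Y : Fin n → Fin s → ℝ)
    (ω : Fin m → ℝ) (δ : Fin s → ℝ) (X0 : Fin m → ℝ) (Y0 : Fin s → ℝ) (lam : Fin n → ℝ)
    (t β : ℝ) (μ : Fin n → ℝ) : Prop :=
  (∀ j, lam j = 0 → 0 ≤ μ j) ∧ (∑ j, μ j) = 0 ∧
    (∀ i, ∑ j, μ j * X j i ≤ -(t * ω i * X0 i)) ∧
    (∀ r, -(β * δ r * Y0 r) ≤ ∑ j, μ j * Y j r)

section

variable {m s n : ℕ} {X : Fin n → Fin m → ℝ} {Y : Fin n → Fin s → ℝ}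
  {ω : Fin m → ℝ} {δ : Fin s → ℝ} {X0 : Fin m → ℝ} {Y0 : Fin s → ℝ} {lam : Fin n → ℝ}

theorem exists_feasibleDirection_of_mem_PPS (h1 : (∑ j, lam j) = 1)
    (hx : ∀ i, ∑ j, lam j * X j i = X0 i) (hy : ∀ r, ∑ j, lam j * Y j r = Y0 r)
    {t β : ℝ} (ht : 0 < t) (h : (scaleX ω (-t) X0, scaleY δ (-β) Y0) ∈ PPS X Y) :
    ∃ μ, FeasibleDirection X Y ω δ X0 Y0 lam 1 (β / t) μ := by
  obtain ⟨l, l0, l1, lx, ly⟩ := h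
  have hsum : ∀ a : Fin n → ℝ, ∑ j, (l j - lam j) / t * a j =
      ((∑ j, l j * a j) - ∑ j, lam j * a j) / t := by
    intro a
    rw [← Finset.sum_sub_distrib, Finset.sum_div]
    exact Finset.sum_congr rfl fun j _ => by ring
  refine ⟨fun j => (l j - lam j) / t, fun j hj => ?_, ?_, fun i => ?_, fun r => ?_⟩
  · simp only [hj, sub_zero]
    exact div_nonneg (l0 j) ht.le
  · rw [← Finset.sum_div, Finset.sum_sub_distrib, l1, h1, sub_self, zero_div]
  · rw [hsum, hx, div_le_iff₀ ht]
    have := lx i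
    simp only [scaleX] at this
    linarith
  · rw [hsum, hy, le_div_iff₀ ht]
    have h2 := ly r
    simp only [scaleY] at h2
    have h3 : -(β / t * δ r * Y0 r) * t = -(β * δ r * Y0 r) := by field_simp
    rw [h3]
    linarith

theorem FeasibleDirection.exists_mem_PPS (h0 : ∀ j, 0 ≤ lam j) (h1 : (∑ j, lam j) = 1)
    (hx : ∀ i, ∑ j, lam j * X j i = X0 i) (hy : ∀ r, ∑ j, lam j * Y j r = Y0 r)
    {t β : ℝ} {μ : Fin n → ℝ} (h : FeasibleDirection X Y ω δ X0 Y0 lam t β μ) :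
    ∃ ε₀ > (0 : ℝ), ∀ ε ∈ Set.Ioc 0 ε₀,
      (scaleX ω (-(ε * t)) X0, scaleY δ (-(ε * β)) Y0) ∈ PPS X Y := by
  obtain ⟨μ0, μ1, μx, μy⟩ := h
  obtain ⟨ε₀, hε₀, hpos⟩ := exists_pos_forall_nonneg_add_mul h0 μ0
  have hsum : ∀ (ε : ℝ) (a : Fin n → ℝ), ∑ j, (lam j + ε * μ j) * a j =
      (∑ j, lam j * a j) + ε * ∑ j, μ j * a j := by
    intro ε a
    rw [Finset.mul_sum, ← Finset.sum_add_distrib]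
    exact Finset.sum_congr rfl fun j _ => by ring
  refine ⟨ε₀, hε₀, fun ε hε => ⟨fun j => lam j + ε * μ j, hpos ε hε, ?_, fun i => ?_,
    fun r => ?_⟩⟩
  · rw [Finset.sum_add_distrib, ← Finset.mul_sum, h1, μ1, mul_zero, add_zero]
  · rw [hsum, hx]
    have := mul_le_mul_of_nonneg_left (μx i) hε.1.le
    simp only [scaleX]
    linarith
  · rw [hsum, hy]
    have := mul_le_mul_of_nonneg_left (μy r) hε.1.le
    simp only [scaleY]
    linarith

theorem StronglyEfficient.nonneg_of_feasibleDirection (hse : StronglyEfficient X Y (X0, Y0))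
    (hδ : ∀ r, 0 ≤ δ r) (hδpos : ∃ r, 0 < δ r) (hY0 : ∀ r, 0 < Y0 r)
    (h0 : ∀ j, 0 ≤ lam j) (h1 : (∑ j, lam j) = 1)
    (hx : ∀ i, ∑ j, lam j * X j i = X0 i) (hy : ∀ r, ∑ j, lam j * Y j r = Y0 r)
    {β : ℝ} {μ : Fin n → ℝ} (h : FeasibleDirection X Y ω δ X0 Y0 lam 0 β μ) : 0 ≤ β := by
  by_contra! hβ
  obtain ⟨ε, hε, hmem⟩ := h.exists_mem_PPS h0 h1 hx hy
  have hεβ : 0 < -(ε * β) := neg_pos.2 (mul_neg_of_pos_of_neg hε hβ)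
  refine hse.2 ⟨_, hmem ε ⟨hε, le_rfl⟩, fun i => ?_, fun r => ?_, fun heq => ?_⟩
  · simp [scaleX]
  · have := mul_nonneg (mul_nonneg (hδ r) hεβ.le) (hY0 r).le
    simp only [scaleY]
    linarith
  · obtain ⟨r, hr⟩ := hδpos
    have h2 := congrFun (congrArg Prod.snd heq) r
    have := mul_pos (mul_pos hr hεβ) (hY0 r)
    simp only [scaleY] at h2
    linarith

/-- If no feasible direction increases outputs at constant inputs, there is a feasible direction
reducing inputs at unit rate with the least rate of output reduction. -/
theorem exists_min_feasibleDirection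
    (hne : ∃ β μ, FeasibleDirection X Y ω δ X0 Y0 lam 1 β μ)
    (hrec : ∀ β μ, FeasibleDirection X Y ω δ X0 Y0 lam 0 β μ → 0 ≤ β) :
    ∃ c μ, FeasibleDirection X Y ω δ X0 Y0 lam 1 c μ ∧
      ∀ β ν, FeasibleDirection X Y ω δ X0 Y0 lam 1 β ν → c ≤ β := by
  let pr : Fin n → (ℝ × (Fin n → ℝ)) →ₗ[ℝ] ℝ :=
    fun j => LinearMap.proj j ∘ₗ LinearMap.snd ℝ ℝ (Fin n → ℝ)
  let g : ({j // lam j = 0} ⊕ Bool) ⊕ (Fin m ⊕ Fin s) → (ℝ × (Fin n → ℝ)) →ₗ[ℝ] ℝ :=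
    Sum.elim (Sum.elim (fun j => -pr j) (fun b => cond b (∑ j, pr j) (-∑ j, pr j)))
      (Sum.elim (fun i => ∑ j, X j i • pr j)
        (fun r => -(δ r * Y0 r) • LinearMap.fst ℝ ℝ (Fin n → ℝ) - ∑ j, Y j r • pr j))
  let b : ℝ → ({j // lam j = 0} ⊕ Bool) ⊕ (Fin m ⊕ Fin s) → ℝ :=
    fun t => Sum.elim (fun _ => 0) (Sum.elim (fun i => -(t * ω i * X0 i)) fun _ => 0)
  have hiff : ∀ t β μ, FeasibleDirection X Y ω δ X0 Y0 lam t β μ ↔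
      ∀ k, g k (β, μ) ≤ b t k := by
    intro t β μ
    have hY : ∀ r, -(β * δ r * Y0 r) ≤ ∑ j, μ j * Y j r ↔
        -(δ r * Y0 r * β) ≤ ∑ j, Y j r * μ j := by
      intro r
      rw [show β * δ r * Y0 r = δ r * Y0 r * β by ring]
      simp only [mul_comm]
    simp only [FeasibleDirection, Sum.forall, Bool.forall_bool, Subtype.forall, hY]
    simp [g, b, pr, mul_comm, le_antisymm_iff]
    tauto
  obtain ⟨β₀, μ₀, h₀⟩ := hne
  obtain ⟨⟨c, μ⟩, hc, hmin⟩ := exists_isMinOn_polyhedron g (b 1)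
    (LinearMap.fst ℝ ℝ (Fin n → ℝ)) ⟨(β₀, μ₀), (hiff 1 β₀ μ₀).1 h₀⟩ (by
      rintro ⟨β, μ⟩ hd
      refine hrec β μ ((hiff 0 β μ).2 fun k => (hd k).trans_eq ?_)
      rcases k with k | k | k <;> simp [b])
  exact ⟨c, μ, (hiff 1 c μ).2 hc, fun β ν h => hmin (β, ν) ((hiff 1 β ν).1 h)⟩

end

/-- Theorem 5: there is t0 > 0 such that β₋(t)/t is constant on (0, t0]. -/
theorem left_hand_ratio_constant
    {m s n : ℕ} (hm : 1 ≤ m) (hs : 1 ≤ s) (hn : 1 ≤ n)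
    (X : Fin n → Fin m → ℝ) (Y : Fin n → Fin s → ℝ)
    (hX : ∀ j i, 0 < X j i) (hY : ∀ j r, 0 < Y j r)
    (ω : Fin m → ℝ) (δ : Fin s → ℝ)
    (hω : ∀ i, 0 ≤ ω i) (hδ : ∀ r, 0 ≤ δ r)
    (hωsum : (∑ i, ω i) = (m : ℝ)) (hδsum : (∑ r, δ r) = (s : ℝ))
    (X0 : Fin m → ℝ) (Y0 : Fin s → ℝ)
    (hX0 : ∀ i, 0 < X0 i) (hY0 : ∀ r, 0 < Y0 r)
    (hse : StronglyEfficient X Y (X0, Y0))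
    (hnd : ¬ DSSS X Y ω δ X0 Y0)
    (βm : ℝ → ℝ)
    (hβm : ∀ t : ℝ, 0 < t →
      {β : ℝ | (scaleX ω (-t) X0, scaleY δ (-β) Y0) ∈ PPS X Y}.Nonempty →
      IsLeast {β : ℝ | (scaleX ω (-t) X0, scaleY δ (-β) Y0) ∈ PPS X Y} (βm t)) :
    ∃ t0 > (0 : ℝ), ∃ c : ℝ, ∀ t ∈ Set.Ioc (0 : ℝ) t0, βm t / t = c := by
  obtain ⟨lam, h0, h1, hx, hy⟩ := hse.exists_weights
  have hδpos : ∃ r, 0 < δ r := by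
    by_contra! h
    have h2 : ∑ r, δ r ≤ 0 := Finset.sum_nonpos fun r _ => h r
    have h3 : (1 : ℝ) ≤ s := by exact_mod_cast hs
    linarith
  have hne : ∃ β μ, FeasibleDirection X Y ω δ X0 Y0 lam 1 β μ := by
    unfold DSSS at hnd
    push Not at hnd
    obtain ⟨t, ht, β, hmem⟩ := hnd
    exact ⟨_, exists_feasibleDirection_of_mem_PPS h1 hx hy (t := -t) (β := -β) (neg_pos.2 ht)
      (by simpa using hmem)⟩
  obtain ⟨c, μ, hc, hmin⟩ := exists_min_feasibleDirection hne fun β μ h =>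
    hse.nonneg_of_feasibleDirection hδ hδpos hY0 h0 h1 hx hy h
  obtain ⟨t0, ht0, hmem⟩ := hc.exists_mem_PPS h0 h1 hx hy
  refine ⟨t0, ht0, c, fun t ht => ?_⟩
  have hct := hmem t ht
  rw [mul_one] at hct
  have hleast := hβm t ht.1 ⟨t * c, hct⟩
  obtain ⟨ν, hν⟩ := exists_feasibleDirection_of_mem_PPS h1 hx hy ht.1 hleast.1
  refine le_antisymm ((div_le_iff₀ ht.1).2 ?_) (hmin _ ν hν)
  rw [mul_comm]
  exact hleast.2 hct
end

section
/- Let (X0,Y0) ∈ PPS be strongly efficient with all components positive and not of the directional smallest scale size. Let F be the set of triples (U,V,μ0) ∈ ℝ^s × ℝ^m × ℝ with U ≥ 0, V ≥ 0, U^T Y_j − V^T X_j + μ0 ≤ 0 for all j = 1,…,n, U^T Y0 − V^T X0 + μ0 = 0, and V^T X0 = 1, and assume Σ_r u_r δ_r y_{r0} > 0 for every (U,V,μ0) ∈ F. Let ρ̄ and ρ̲ be the supremum and infimum, respectively, of the ratio (Σ_i v_i ω_i x_{i0})/(Σ_r u_r δ_r y_{r0}) over F. For t ≥ 0 let β(t)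 = max{β : (Ω_t X0, Φ_β Y0) ∈ PPS}, and for small t > 0 let β₋(t) = min{β : (Ω_{−t} X0, Φ_{−β} Y0) ∈ PPS}. Then there exists t0 > 0 such that for all t ∈ (0, t0]: ρ̲ = β(t)/t and ρ̄ = β₋(t)/t. -/
open Finset Set

/-- **Farkas' lemma** for finitely many linear functionals on a real vector space. -/
theorem exists_nonneg_combination_of_forall_nonpos {W ι : Type*} [AddCommGroup W] [Module ℝ W]
    (S : Finset ι) (a : ι → W →ₗ[ℝ] ℝ) (b : W →ₗ[ℝ] ℝ)
    (h : ∀ x, (∀ i ∈ S, a i x ≤ 0) → b x ≤ 0) :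
    ∃ c : ι → ℝ, (∀ i, 0 ≤ c i) ∧ ∀ x, b x = ∑ i ∈ S, c i * a i x := by
  classical
  induction S using Finset.induction_on generalizing a b with
  | empty =>
    refine ⟨0, by simp, fun x => ?_⟩
    have h1 := h x (by simp)
    have h2 := h (-x) (by simp)
    rw [map_neg] at h2
    simp only [Finset.sum_empty]
    linarith
  | insert k S hk ih =>
    by_cases hS : ∀ x, (∀ i ∈ S, a i x ≤ 0) → b x ≤ 0
    · obtain ⟨c, hc, hb⟩ := ih a b hS
      refine ⟨Function.update c k 0, fun i => ?_, fun x => ?_⟩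
      · by_cases hik : i = k
        · simp [hik]
        · simpa [hik] using hc i
      · rw [Finset.sum_insert hk, hb x]
        simp only [Function.update_self, zero_mul, zero_add]
        refine Finset.sum_congr rfl fun i hi => ?_
        rw [Function.update_of_ne (ne_of_mem_of_not_mem hi hk)]
    · push Not at hS
      obtain ⟨z, hz, hbz⟩ := hS
      have hkz : 0 < a k z := by
        by_contra hneg
        exact absurd (h z (by simpa using ⟨not_lt.mp hneg, hz⟩)) (not_le.mpr hbz)
      obtain ⟨c, hc, hb⟩ := ih (fun i => a i - (a i z / a k z) • a k)
        (b - (b z / a k z) • a k) (by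
          intro x hx
          have key := h (x - (a k x / a k z) • z) (by
            intro i hi
            rcases Finset.mem_insert.mp hi with rfl | hi
            · simp [hkz.ne']
            · have := hx i hi
              simp only [LinearMap.sub_apply, LinearMap.smul_apply, smul_eq_mul, map_sub,
                map_smul] at this ⊢
              calc _ = a i x - a i z / a k z * a k x := by ring
                _ ≤ 0 := this)
          simp only [LinearMap.sub_apply, LinearMap.smul_apply, smul_eq_mul, map_sub,
            map_smul] at key ⊢
          calc _ = b x - a k x / a k z * b z := by ring
            _ ≤ 0 := key)
      have hcz : ∑ i ∈ S, c i * (a i z / a k z) ≤ 0 :=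
        Finset.sum_nonpos fun i hi => mul_nonpos_of_nonneg_of_nonpos (hc i)
          (div_nonpos_of_nonpos_of_nonneg (hz i hi) hkz.le)
      have hbz' : 0 < b z / a k z := div_pos hbz hkz
      refine ⟨Function.update c k (b z / a k z - ∑ i ∈ S, c i * (a i z / a k z)),
        fun i => ?_, fun x => ?_⟩
      · by_cases hik : i = k
        · subst hik
          rw [Function.update_self]
          linarith
        · simpa [hik] using hc i
      · have hx := hb x
        simp only [LinearMap.sub_apply, LinearMap.smul_apply, smul_eq_mul, mul_sub,
          Finset.sum_sub_distrib] at hx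
        rw [Finset.sum_insert hk, Function.update_self]
        have hcongr : ∑ i ∈ S, Function.update c k
            (b z / a k z - ∑ i ∈ S, c i * (a i z / a k z)) i * a i x = ∑ i ∈ S, c i * a i x :=
          Finset.sum_congr rfl fun i hi => by
            rw [Function.update_of_ne (ne_of_mem_of_not_mem hi hk)]
        rw [hcongr, sub_mul, Finset.sum_mul]
        simp only [mul_assoc] at hx ⊢
        linarith

/-- The functional `(U, V) ↦ U ⬝ dy - V ⬝ dx`. -/
noncomputable def netValue {m s : ℕ} (dx : Fin m → ℝ) (dy : Fin s → ℝ) :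
    ((Fin s → ℝ) × (Fin m → ℝ)) →ₗ[ℝ] ℝ where
  toFun p := ∑ r, p.1 r * dy r - ∑ i, p.2 i * dx i
  map_add' p q := by
    simp only [Prod.fst_add, Prod.snd_add, Pi.add_apply, add_mul, Finset.sum_add_distrib]
    ring
  map_smul' c p := by
    simp only [Prod.smul_fst, Prod.smul_snd, Pi.smul_apply, smul_eq_mul, mul_assoc,
      RingHom.id_apply, ← Finset.mul_sum, mul_sub]

theorem netValue_apply {m s : ℕ} (dx : Fin m → ℝ) (dy : Fin s → ℝ)
    (p : (Fin s → ℝ) × (Fin m → ℝ)) :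
    netValue dx dy p = ∑ r, p.1 r * dy r - ∑ i, p.2 i * dx i := rfl

/-- The outer normal cone of the production possibility set at `(X0, Y0)`. -/
def normalCone {m s n : ℕ} (X : Fin n → Fin m → ℝ) (Y : Fin n → Fin s → ℝ)
    (X0 : Fin m → ℝ) (Y0 : Fin s → ℝ) : Set ((Fin s → ℝ) × (Fin m → ℝ)) :=
  {p | (∀ r, 0 ≤ p.1 r) ∧ (∀ i, 0 ≤ p.2 i) ∧
    ∀ j, netValue (fun i => X j i - X0 i) (fun r => Y j r - Y0 r) p ≤ 0}

/-- A direction that is nonpositive on the normal cone is a feasible direction. -/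
theorem exists_step_mem_PPS {m s n : ℕ} {X : Fin n → Fin m → ℝ} {Y : Fin n → Fin s → ℝ}
    {X0 : Fin m → ℝ} {Y0 : Fin s → ℝ} (h0 : (X0, Y0) ∈ PPS X Y)
    (dx : Fin m → ℝ) (dy : Fin s → ℝ)
    (h : ∀ p ∈ normalCone X Y X0 Y0, netValue dx dy p ≤ 0) :
    ∃ ε > (0 : ℝ), ∀ t ∈ Set.Ioc (0 : ℝ) ε,
      ((fun i => X0 i + t * dx i, fun r => Y0 r + t * dy r) :
        (Fin m → ℝ) × (Fin s → ℝ)) ∈ PPS X Y := by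
  classical
  obtain ⟨c, hc, hcomb⟩ := exists_nonneg_combination_of_forall_nonpos
    (Finset.univ : Finset (Fin n ⊕ Fin m ⊕ Fin s))
    (Sum.elim (fun j => netValue (fun i => X j i - X0 i) (fun r => Y j r - Y0 r))
      (Sum.elim (fun i => netValue (Pi.single i 1) 0)
        (fun r => netValue 0 (-Pi.single r 1))))
    (netValue dx dy) (by
      intro p hp
      refine h p ⟨fun r => ?_, fun i => ?_, fun j => ?_⟩
      · simpa [netValue_apply, Pi.single_apply] using hp (.inr (.inr r)) (Finset.mem_univ _)
      · simpa [netValue_apply, Pi.single_apply] using hp (.inr (.inl i)) (Finset.mem_univ _)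
      · exact hp (.inl j) (Finset.mem_univ _))
  have hdx : ∀ i, ∑ j, c (.inl j) * (X j i - X0 i) ≤ dx i := fun i => by
    have hi := hcomb (0, Pi.single i 1)
    simp [netValue_apply, Pi.single_apply] at hi
    have := hc (.inr (.inl i))
    simp only [mul_sub, Finset.sum_sub_distrib] at hi ⊢
    linarith
  have hdy : ∀ r, dy r ≤ ∑ j, c (.inl j) * (Y j r - Y0 r) := fun r => by
    have hr := hcomb (Pi.single r 1, 0)
    simp [netValue_apply, Pi.single_apply] at hr
    have := hc (.inr (.inr r))
    simp only [mul_sub, Finset.sum_sub_distrib] at hr ⊢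
    linarith
  obtain ⟨lam, hlam, hsum, hlx, hly⟩ := h0
  set C : ℝ := ∑ j, c (.inl j) with hC
  have hC0 : 0 ≤ C := Finset.sum_nonneg fun j _ => hc _
  have hexpand : ∀ (t : ℝ) (f : Fin n → ℝ),
      ∑ j, ((1 - t * C) * lam j + t * c (.inl j)) * f j =
        (1 - t * C) * ∑ j, lam j * f j + t * ∑ j, c (.inl j) * f j := fun t f => by
    simp only [add_mul, Finset.sum_add_distrib, mul_assoc, Finset.mul_sum]
  refine ⟨1 / (C + 1), by positivity, fun t ht => ?_⟩
  have htC : 0 ≤ 1 - t * C := by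
    have := (le_div_iff₀ (by linarith)).mp ht.2
    nlinarith [ht.1]
  refine ⟨fun j => (1 - t * C) * lam j + t * c (.inl j), fun j => ?_, ?_, fun i => ?_,
    fun r => ?_⟩
  · have := mul_nonneg htC (hlam j)
    have := mul_nonneg ht.1.le (hc (.inl j))
    linarith
  · have := hexpand t 1
    simp only [Pi.one_apply, mul_one, hsum, ← hC] at this
    linarith
  · have h1 := mul_le_mul_of_nonneg_left (hlx i) htC
    have h2 := mul_le_mul_of_nonneg_left (hdx i) ht.1.le
    simp only [mul_sub, Finset.sum_sub_distrib, ← Finset.sum_mul, ← hC] at h2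
    rw [hexpand t fun j => X j i]
    dsimp only at h1 ⊢
    linarith
  · have h1 := mul_le_mul_of_nonneg_left (hly r) htC
    have h2 := mul_le_mul_of_nonneg_left (hdy r) ht.1.le
    simp only [mul_sub, Finset.sum_sub_distrib, ← Finset.sum_mul, ← hC] at h2
    rw [hexpand t fun j => Y j r]
    dsimp only at h1 ⊢
    linarith

/-- A normal vector that does not vanish on `X0` gives, after normalization, a point of `Fset`. -/
theorem exists_mem_Fset_of_mem_normalCone {m s n : ℕ} {X : Fin n → Fin m → ℝ}
    {Y : Fin n → Fin s → ℝ} {X0 : Fin m → ℝ} {Y0 : Fin s → ℝ}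
    {p : (Fin s → ℝ) × (Fin m → ℝ)} (hp : p ∈ normalCone X Y X0 Y0)
    (hpX : 0 < ∑ i, p.2 i * X0 i) :
    ∃ μ : ℝ, (((∑ i, p.2 i * X0 i)⁻¹ • p.1, (∑ i, p.2 i * X0 i)⁻¹ • p.2, μ) :
      (Fin s → ℝ) × (Fin m → ℝ) × ℝ) ∈ Fset X Y X0 Y0 := by
  obtain ⟨hU, hV, hN⟩ := hp
  set c := ∑ i, p.2 i * X0 i with hc
  have hc' : 0 ≤ c⁻¹ := (inv_pos.mpr hpX).le
  refine ⟨c⁻¹ * c - c⁻¹ * ∑ r, p.1 r * Y0 r, fun r => mul_nonneg hc' (hU r),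
    fun i => mul_nonneg hc' (hV i), fun j => ?_, ?_, ?_⟩
  · have := mul_nonpos_of_nonneg_of_nonpos hc' (hN j)
    simp only [netValue_apply, mul_sub, Finset.sum_sub_distrib, ← hc] at this
    simp only [Pi.smul_apply, smul_eq_mul, mul_assoc, ← Finset.mul_sum]
    linarith
  · simp only [Pi.smul_apply, smul_eq_mul, mul_assoc, ← Finset.mul_sum, ← hc]
    ring
  · simp only [Pi.smul_apply, smul_eq_mul, mul_assoc, ← Finset.mul_sum, ← hc]
    exact inv_mul_cancel₀ hpX.ne'

theorem mem_normalCone_of_mem_Fset {m s n : ℕ} {X : Fin n → Fin m → ℝ}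
    {Y : Fin n → Fin s → ℝ} {X0 : Fin m → ℝ} {Y0 : Fin s → ℝ}
    {p : (Fin s → ℝ) × (Fin m → ℝ) × ℝ} (hp : p ∈ Fset X Y X0 Y0) :
    (p.1, p.2.1) ∈ normalCone X Y X0 Y0 := by
  obtain ⟨hU, hV, hN, h0, -⟩ := hp
  refine ⟨hU, hV, fun j => ?_⟩
  have := hN j
  simp only [netValue_apply, mul_sub, Finset.sum_sub_distrib]
  linarith

theorem netValue_nonpos_of_mem_PPS {m s n : ℕ} {X : Fin n → Fin m → ℝ}
    {Y : Fin n → Fin s → ℝ} {X0 : Fin m → ℝ} {Y0 : Fin s → ℝ}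
    {p : (Fin s → ℝ) × (Fin m → ℝ)} (hp : p ∈ normalCone X Y X0 Y0)
    {q : (Fin m → ℝ) × (Fin s → ℝ)} (hq : q ∈ PPS X Y) :
    netValue (fun i => q.1 i - X0 i) (fun r => q.2 r - Y0 r) p ≤ 0 := by
  obtain ⟨hU, hV, hN⟩ := hp
  obtain ⟨lam, hlam, hsum, hx, hy⟩ := hq
  have hcomb : ∑ j, lam j * netValue (fun i => X j i - X0 i) (fun r => Y j r - Y0 r) p ≤ 0 :=
    Finset.sum_nonpos fun j _ => mul_nonpos_of_nonneg_of_nonpos (hlam j) (hN j)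
  have hxs : ∑ i, p.2 i * ∑ j, lam j * X j i ≤ ∑ i, p.2 i * q.1 i :=
    Finset.sum_le_sum fun i _ => mul_le_mul_of_nonneg_left (hx i) (hV i)
  have hys : ∑ r, p.1 r * q.2 r ≤ ∑ r, p.1 r * ∑ j, lam j * Y j r :=
    Finset.sum_le_sum fun r _ => mul_le_mul_of_nonneg_left (hy r) (hU r)
  have hxc : ∑ i, p.2 i * ∑ j, lam j * X j i = ∑ j, lam j * ∑ i, p.2 i * X j i := by
    simp only [Finset.mul_sum]
    rw [Finset.sum_comm]
    exact Finset.sum_congr rfl fun j _ => Finset.sum_congr rfl fun i _ => by ring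
  have hyc : ∑ r, p.1 r * ∑ j, lam j * Y j r = ∑ j, lam j * ∑ r, p.1 r * Y j r := by
    simp only [Finset.mul_sum]
    rw [Finset.sum_comm]
    exact Finset.sum_congr rfl fun j _ => Finset.sum_congr rfl fun i _ => by ring
  simp only [netValue_apply, mul_sub, Finset.sum_sub_distrib, ← Finset.sum_mul, hsum,
    one_mul] at hcomb ⊢
  linarith

/-- If `Fset` is nonempty, an inequality valid on `Fset` holds on the whole normal cone. -/
theorem netValue_nonpos_of_forall_Fset {m s n : ℕ} {X : Fin n → Fin m → ℝ}
    {Y : Fin n → Fin s → ℝ} {X0 : Fin m → ℝ} {Y0 : Fin s → ℝ} (hX0 : ∀ i, 0 < X0 i)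
    (hne : (Fset X Y X0 Y0).Nonempty) {dx : Fin m → ℝ} {dy : Fin s → ℝ}
    (h : ∀ p ∈ Fset X Y X0 Y0, netValue dx dy (p.1, p.2.1) ≤ 0)
    {q : (Fin s → ℝ) × (Fin m → ℝ)} (hq : q ∈ normalCone X Y X0 Y0) :
    netValue dx dy q ≤ 0 := by
  have hpos : ∀ w ∈ normalCone X Y X0 Y0, 0 < ∑ i, w.2 i * X0 i → netValue dx dy w ≤ 0 := by
    intro w hw hwX
    obtain ⟨μ, hμ⟩ := exists_mem_Fset_of_mem_normalCone hw hwX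
    have h1 : netValue dx dy ((∑ i, w.2 i * X0 i)⁻¹ • w) ≤ 0 := h _ hμ
    rw [map_smul, smul_eq_mul] at h1
    exact nonpos_of_mul_nonpos_right h1 (inv_pos.mpr hwX)
  obtain ⟨p, hp⟩ := hne
  have hpN := mem_normalCone_of_mem_Fset hp
  have hpX : ∑ i, p.2.1 i * X0 i = 1 := hp.2.2.2.2
  have hqX : 0 ≤ ∑ i, q.2 i * X0 i :=
    Finset.sum_nonneg fun i _ => mul_nonneg (hq.2.1 i) (hX0 i).le
  have hray : ∀ k : ℝ, 0 ≤ k → netValue dx dy (p.1, p.2.1) + k * netValue dx dy q ≤ 0 := by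
    intro k hk
    have := hpos ((p.1, p.2.1) + k • q)
      ⟨fun r => add_nonneg (hpN.1 r) (mul_nonneg hk (hq.1 r)),
        fun i => add_nonneg (hpN.2.1 i) (mul_nonneg hk (hq.2.1 i)), fun j => by
          rw [map_add, map_smul, smul_eq_mul]
          exact add_nonpos (hpN.2.2 j) (mul_nonpos_of_nonneg_of_nonpos hk (hq.2.2 j))⟩ (by
        simp only [Prod.snd_add, Prod.smul_snd, Pi.add_apply, Pi.smul_apply, smul_eq_mul,
          add_mul, Finset.sum_add_distrib, mul_assoc, ← Finset.mul_sum, hpX]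
        positivity)
    rwa [map_add, map_smul, smul_eq_mul] at this
  by_contra hneg
  push Not at hneg
  have h1 := hray ((1 + |netValue dx dy (p.1, p.2.1)|) / netValue dx dy q) (by positivity)
  rw [div_mul_cancel₀ _ hneg.ne'] at h1
  linarith [neg_abs_le (netValue dx dy (p.1, p.2.1))]

theorem Fset_nonempty_of_stronglyEfficient {m s n : ℕ} (hm : 1 ≤ m) {X : Fin n → Fin m → ℝ}
    {Y : Fin n → Fin s → ℝ} {X0 : Fin m → ℝ} {Y0 : Fin s → ℝ} (hX0 : ∀ i, 0 < X0 i)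
    (hse : StronglyEfficient X Y (X0, Y0)) : (Fset X Y X0 Y0).Nonempty := by
  by_contra hempty
  obtain ⟨ε, hε, hstep⟩ := exists_step_mem_PPS hse.1 (fun _ => -1) (fun _ => 0) (by
    intro p hp
    have hnn : ∀ i, 0 ≤ p.2 i * X0 i := fun i => mul_nonneg (hp.2.1 i) (hX0 i).le
    have hz : ∑ i, p.2 i * X0 i = 0 := by
      refine le_antisymm (not_lt.mp fun hlt => hempty ?_) (Finset.sum_nonneg fun i _ => hnn i)
      obtain ⟨μ, hμ⟩ := exists_mem_Fset_of_mem_normalCone hp hlt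
      exact ⟨_, hμ⟩
    have hV : ∀ i, p.2 i = 0 := fun i =>
      (mul_eq_zero.mp ((Finset.sum_eq_zero_iff_of_nonneg fun i _ => hnn i).mp hz i
        (Finset.mem_univ i))).resolve_right (hX0 i).ne'
    simp [netValue_apply, hV])
  refine hse.2 ⟨_, hstep ε ⟨hε, le_rfl⟩, fun i => ?_, fun r => ?_, fun heq => ?_⟩
  · dsimp only
    linarith
  · simp
  · have := congrFun (congrArg Prod.fst heq) ⟨0, hm⟩
    dsimp only at this
    linarith

/-- Membership of a scaled point bounds the scaling on every element of `Fset`. -/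
theorem scale_le_of_mem_PPS {m s n : ℕ} {X : Fin n → Fin m → ℝ}
    {Y : Fin n → Fin s → ℝ} {X0 : Fin m → ℝ} {Y0 : Fin s → ℝ} {ω : Fin m → ℝ} {δ : Fin s → ℝ}
    {p : (Fin s → ℝ) × (Fin m → ℝ) × ℝ} (hp : p ∈ Fset X Y X0 Y0) {t β : ℝ}
    (h : (scaleX ω t X0, scaleY δ β Y0) ∈ PPS X Y) :
    β * ∑ r, p.1 r * δ r * Y0 r ≤ t * ∑ i, p.2.1 i * ω i * X0 i := by
  have := netValue_nonpos_of_mem_PPS (mem_normalCone_of_mem_Fset hp) h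
  rw [netValue_apply, sub_nonpos] at this
  rw [Finset.mul_sum, Finset.mul_sum]
  calc _ = _ := Finset.sum_congr rfl fun r _ => by simp only [scaleY]; ring
    _ ≤ _ := this
    _ = _ := Finset.sum_congr rfl fun i _ => by simp only [scaleX]; ring

/-- A scaling direction satisfying the inequalities of `Fset` is feasible for small steps. -/
theorem exists_scale_mem_PPS {m s n : ℕ} {X : Fin n → Fin m → ℝ}
    {Y : Fin n → Fin s → ℝ} {X0 : Fin m → ℝ} {Y0 : Fin s → ℝ} (hX0 : ∀ i, 0 < X0 i)
    (h0 : (X0, Y0) ∈ PPS X Y) (hne : (Fset X Y X0 Y0).Nonempty)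
    (ω : Fin m → ℝ) (δ : Fin s → ℝ) (a b : ℝ)
    (h : ∀ p ∈ Fset X Y X0 Y0,
      b * ∑ r, p.1 r * δ r * Y0 r ≤ a * ∑ i, p.2.1 i * ω i * X0 i) :
    ∃ ε > (0 : ℝ), ∀ t ∈ Set.Ioc (0 : ℝ) ε,
      (scaleX ω (t * a) X0, scaleY δ (t * b) Y0) ∈ PPS X Y := by
  obtain ⟨ε, hε, hstep⟩ := exists_step_mem_PPS h0 (fun i => a * (ω i * X0 i))
    (fun r => b * (δ r * Y0 r)) (fun q hq => netValue_nonpos_of_forall_Fset hX0 hne (by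
      intro p hp
      have := h p hp
      rw [netValue_apply, sub_nonpos]
      rw [Finset.mul_sum, Finset.mul_sum] at this
      calc _ = _ := Finset.sum_congr rfl fun r _ => by ring
        _ ≤ _ := this
        _ = _ := Finset.sum_congr rfl fun i _ => by ring) hq)
  refine ⟨ε, hε, fun t ht => ?_⟩
  convert hstep t ht using 2
  · funext i
    simp only [scaleX]
    ring
  · funext r
    simp only [scaleY]
    ring

/-- Theorem 6: the lower/upper bounds of the fractional program (Model 28) equal
the right-hand ratio β(t)/t and the left-hand ratio β₋(t)/t for small t > 0. -/
theorem bounds_equal_one_sided_ratios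
    {m s n : ℕ} (hm : 1 ≤ m) (hs : 1 ≤ s) (hn : 1 ≤ n)
    (X : Fin n → Fin m → ℝ) (Y : Fin n → Fin s → ℝ)
    (hX : ∀ j i, 0 < X j i) (hY : ∀ j r, 0 < Y j r)
    (ω : Fin m → ℝ) (δ : Fin s → ℝ)
    (hω : ∀ i, 0 ≤ ω i) (hδ : ∀ r, 0 ≤ δ r)
    (hωsum : (∑ i, ω i) = (m : ℝ)) (hδsum : (∑ r, δ r) = (s : ℝ))
    (X0 : Fin m → ℝ) (Y0 : Fin s → ℝ)
    (hX0 : ∀ i, 0 < X0 i) (hY0 : ∀ r, 0 < Y0 r)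
    (hse : StronglyEfficient X Y (X0, Y0))
    (hnd : ¬ DSSS X Y ω δ X0 Y0)
    (hpos : ∀ p ∈ Fset X Y X0 Y0, 0 < ∑ r, p.1 r * δ r * Y0 r)
    (βf : ℝ → ℝ)
    (hβf : ∀ t : ℝ, 0 ≤ t →
      IsGreatest {β : ℝ | (scaleX ω t X0, scaleY δ β Y0) ∈ PPS X Y} (βf t))
    (βm : ℝ → ℝ)
    (hβm : ∀ t : ℝ, 0 < t →
      {β : ℝ | (scaleX ω (-t) X0, scaleY δ (-β) Y0) ∈ PPS X Y}.Nonempty →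
      IsLeast {β : ℝ | (scaleX ω (-t) X0, scaleY δ (-β) Y0) ∈ PPS X Y} (βm t)) :
    ∃ t0 > (0 : ℝ), ∀ t ∈ Set.Ioc (0 : ℝ) t0,
      sInf (seRatio ω δ X0 Y0 '' Fset X Y X0 Y0) = βf t / t ∧
      sSup (seRatio ω δ X0 Y0 '' Fset X Y X0 Y0) = βm t / t := by
  have hne := Fset_nonempty_of_stronglyEfficient hm hX0 hse
  set R := seRatio ω δ X0 Y0 '' Fset X Y X0 Y0 with hR
  have hRne : R.Nonempty := hne.image _
  have hRbelow : BddBelow R := by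
    refine ⟨0, ?_⟩
    rintro _ ⟨p, hp, rfl⟩
    exact div_nonneg (Finset.sum_nonneg fun i _ =>
      mul_nonneg (mul_nonneg (hp.2.1 i) (hω i)) (hX0 i).le) (hpos p hp).le
  have hRabove : BddAbove R := by
    simp only [DSSS, not_forall, not_not] at hnd
    obtain ⟨t, ht, β, hmem⟩ := hnd
    refine ⟨β / t, ?_⟩
    rintro _ ⟨p, hp, rfl⟩
    have := scale_le_of_mem_PPS hp hmem
    rw [seRatio, div_le_iff₀ (hpos p hp), div_mul_eq_mul_div, le_div_iff_of_neg ht]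
    linarith
  obtain ⟨ε₁, hε₁, hright⟩ := exists_scale_mem_PPS hX0 hse.1 hne ω δ 1 (sInf R) (by
    intro p hp
    have := csInf_le hRbelow (mem_image_of_mem _ hp)
    rw [seRatio, le_div_iff₀ (hpos p hp)] at this
    linarith)
  obtain ⟨ε₂, hε₂, hleft⟩ := exists_scale_mem_PPS hX0 hse.1 hne ω δ (-1) (-sSup R) (by
    intro p hp
    have := le_csSup hRabove (mem_image_of_mem _ hp)
    rw [seRatio, div_le_iff₀ (hpos p hp)] at this
    linarith)
  refine ⟨min ε₁ ε₂, lt_min hε₁ hε₂, fun t ht => ⟨le_antisymm ?_ ?_, le_antisymm ?_ ?_⟩⟩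
  · rw [le_div_iff₀ ht.1, mul_comm]
    refine (hβf t ht.1.le).2 ?_
    simpa using hright t ⟨ht.1, ht.2.trans (min_le_left _ _)⟩
  · refine le_csInf hRne ?_
    rintro _ ⟨p, hp, rfl⟩
    have := scale_le_of_mem_PPS hp (hβf t ht.1.le).1
    rw [seRatio, le_div_iff₀ (hpos p hp), div_mul_eq_mul_div, div_le_iff₀ ht.1]
    linarith
  all_goals
    have hmem : t * sSup R ∈
        {β : ℝ | (scaleX ω (-t) X0, scaleY δ (-β) Y0) ∈ PPS X Y} := by
      simpa using hleft t ⟨ht.1, ht.2.trans (min_le_right _ _)⟩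
    have hleast := hβm t ht.1 ⟨_, hmem⟩
  · refine csSup_le hRne ?_
    rintro _ ⟨p, hp, rfl⟩
    have := scale_le_of_mem_PPS hp hleast.1
    rw [seRatio, div_le_iff₀ (hpos p hp), div_mul_eq_mul_div, le_div_iff₀ ht.1]
    linarith
  · rw [div_le_iff₀ ht.1, mul_comm]
    exact hleast.2 hmem
end

section
/- Let (X0,Y0) ∈ PPS be strongly efficient with all components positive. Let F be the set of triples (U,V,μ0) ∈ ℝ^s × ℝ^m × ℝ with U ≥ 0, V ≥ 0, U^T Y_j − V^T X_j + μ0 ≤ 0 for all j = 1,…,n, U^T Y0 − V^T X0 + μ0 = 0, and V^T X0 = 1. If for every M ∈ ℝ there exists (U,V,μ0) ∈ F with Σ_i v_i ω_i x_{i0} > M · Σ_r u_r δ_r y_{r0} (i.e., the fractional objective of Model (28) is unbounded above over F), then (X0,Y0) is of the directional smallest scale size. -/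
open Finset Set

/-- A nonnegative multiplier bundle that is nonpositive at every observed unit
is nonpositive on the whole production possibility set. -/
theorem multiplier_nonpos_of_mem_PPS {m s n : ℕ}
    {X : Fin n → Fin m → ℝ} {Y : Fin n → Fin s → ℝ}
    {U : Fin s → ℝ} {V : Fin m → ℝ} {μ0 : ℝ}
    (hU : ∀ r, 0 ≤ U r) (hV : ∀ i, 0 ≤ V i)
    (h : ∀ j, (∑ r, U r * Y j r) - (∑ i, V i * X j i) + μ0 ≤ 0)
    {q : (Fin m → ℝ) × (Fin s → ℝ)} (hq : q ∈ PPS X Y) :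
    (∑ r, U r * q.2 r) - (∑ i, V i * q.1 i) + μ0 ≤ 0 := by
  obtain ⟨lam, hlam, hsum, hx, hy⟩ := hq
  have hUq : ∑ r, U r * q.2 r ≤ ∑ j, lam j * ∑ r, U r * Y j r := by
    calc ∑ r, U r * q.2 r ≤ ∑ r, U r * ∑ j, lam j * Y j r :=
          Finset.sum_le_sum fun r _ => mul_le_mul_of_nonneg_left (hy r) (hU r)
      _ = ∑ j, lam j * ∑ r, U r * Y j r := by
          simp only [Finset.mul_sum, mul_left_comm]
          exact Finset.sum_comm
  have hVq : ∑ j, lam j * ∑ i, V i * X j i ≤ ∑ i, V i * q.1 i := by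
    calc ∑ j, lam j * ∑ i, V i * X j i = ∑ i, V i * ∑ j, lam j * X j i := by
          simp only [Finset.mul_sum, mul_left_comm]
          exact Finset.sum_comm
      _ ≤ ∑ i, V i * q.1 i :=
          Finset.sum_le_sum fun i _ => mul_le_mul_of_nonneg_left (hx i) (hV i)
  have hcomb : ∑ j, lam j * ((∑ r, U r * Y j r) - (∑ i, V i * X j i) + μ0) ≤ 0 :=
    Finset.sum_nonpos fun j _ => mul_nonpos_of_nonneg_of_nonpos (hlam j) (h j)
  simp only [mul_add, mul_sub, Finset.sum_add_distrib, Finset.sum_sub_distrib,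
    ← Finset.sum_mul, hsum, one_mul] at hcomb
  linarith

/-- Weighted sum of a vector scaled along a direction. -/
theorem sum_mul_one_add_mul {k : ℕ} (w d z : Fin k → ℝ) (c : ℝ) :
    ∑ i, w i * ((1 + d i * c) * z i) = (∑ i, w i * z i) + c * ∑ i, w i * d i * z i := by
  rw [Finset.mul_sum, ← Finset.sum_add_distrib]
  exact Finset.sum_congr rfl fun i _ => by ring

/-- Theorem 7: if the fractional objective of Model (28) is unbounded above over F,
then (X0, Y0) is of the directional smallest scale size. -/
theorem unbounded_implies_dsss
    {m s n : ℕ} (hm : 1 ≤ m) (hs : 1 ≤ s) (hn : 1 ≤ n)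
    (X : Fin n → Fin m → ℝ) (Y : Fin n → Fin s → ℝ)
    (hX : ∀ j i, 0 < X j i) (hY : ∀ j r, 0 < Y j r)
    (ω : Fin m → ℝ) (δ : Fin s → ℝ)
    (hω : ∀ i, 0 ≤ ω i) (hδ : ∀ r, 0 ≤ δ r)
    (hωsum : (∑ i, ω i) = (m : ℝ)) (hδsum : (∑ r, δ r) = (s : ℝ))
    (X0 : Fin m → ℝ) (Y0 : Fin s → ℝ)
    (hX0 : ∀ i, 0 < X0 i) (hY0 : ∀ r, 0 < Y0 r)
    (hse : StronglyEfficient X Y (X0, Y0))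
    (hunb : ∀ M : ℝ, ∃ p ∈ Fset X Y X0 Y0,
      M * (∑ r, p.1 r * δ r * Y0 r) < ∑ i, p.2.1 i * ω i * X0 i) :
    DSSS X Y ω δ X0 Y0 := by
  intro t ht β hmem
  obtain ⟨p, ⟨hU, hV, hunits, hzero, -⟩, hlt⟩ := hunb (β / t)
  have hle := multiplier_nonpos_of_mem_PPS hU hV hunits hmem
  simp only [scaleX, scaleY, sum_mul_one_add_mul] at hle
  have hmul := mul_lt_mul_of_neg_left hlt ht
  rw [← mul_assoc, mul_div_cancel₀ _ ht.ne] at hmul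
  linarith
end

section
/- Let (X0,Y0) ∈ PPS have all components positive, let t > 0, and suppose β* = max{β ∈ ℝ : (Ω_t X0, Φ_β Y0) ∈ PPS} is attained. Then the point (Ω_t X0, Φ_{β*} Y0) is weakly efficient, i.e., there is no (X',Y') ∈ PPS with X'_i < (1+ω_i t) x_{i0} for all i and Y'_r > (1+δ_r β*) y_{r0} for all r. -/
open Finset Set

/-- The production possibility set allows free disposal of inputs and outputs. -/
theorem PPS_of_le {m s n : ℕ} {X : Fin n → Fin m → ℝ} {Y : Fin n → Fin s → ℝ}
    {p q : (Fin m → ℝ) × (Fin s → ℝ)} (hq : q ∈ PPS X Y)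
    (hin : ∀ i, q.1 i ≤ p.1 i) (hout : ∀ r, p.2 r ≤ q.2 r) : p ∈ PPS X Y := by
  obtain ⟨lam, hlam, hsum, hqX, hqY⟩ := hq
  exact ⟨lam, hlam, hsum, fun i => (hqX i).trans (hin i), fun r => (hout r).trans (hqY r)⟩

/-- If β* is the maximal output scaling with (Ω_t X0, Φ_{β*} Y0) ∈ PPS, then this
point is weakly efficient. -/
theorem max_point_weakly_efficient
    {m s n : ℕ} (hm : 1 ≤ m) (hs : 1 ≤ s) (hn : 1 ≤ n)
    (X : Fin n → Fin m → ℝ) (Y : Fin n → Fin s → ℝ)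
    (hX : ∀ j i, 0 < X j i) (hY : ∀ j r, 0 < Y j r)
    (ω : Fin m → ℝ) (δ : Fin s → ℝ)
    (hω : ∀ i, 0 ≤ ω i) (hδ : ∀ r, 0 ≤ δ r)
    (hωsum : (∑ i, ω i) = (m : ℝ)) (hδsum : (∑ r, δ r) = (s : ℝ))
    (X0 : Fin m → ℝ) (Y0 : Fin s → ℝ)
    (hX0 : ∀ i, 0 < X0 i) (hY0 : ∀ r, 0 < Y0 r)
    (hp : (X0, Y0) ∈ PPS X Y)
    (t : ℝ) (ht : 0 < t) (βstar : ℝ)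
    (hβ : IsGreatest {β : ℝ | (scaleX ω t X0, scaleY δ β Y0) ∈ PPS X Y} βstar) :
    ¬ ∃ q ∈ PPS X Y, (∀ i, q.1 i < (1 + ω i * t) * X0 i) ∧
      (∀ r, (1 + δ r * βstar) * Y0 r < q.2 r) := by
  rintro ⟨q, hq, hin, hout⟩
  have hev : ∀ᶠ β in nhds βstar, ∀ r, (1 + δ r * β) * Y0 r < q.2 r := by
    refine Filter.eventually_all.2 fun r => ?_
    have hcont : Continuous fun β : ℝ => (1 + δ r * β) * Y0 r := by fun_prop
    exact hcont.continuousAt.eventually_lt continuousAt_const (hout r)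
  obtain ⟨β, hlt, hgt⟩ :=
    ((hev.filter_mono nhdsWithin_le_nhds).and
      (self_mem_nhdsWithin : Set.Ioi βstar ∈ nhdsWithin βstar (Set.Ioi βstar))).exists
  exact (hβ.2 (PPS_of_le hq (fun i => (hin i).le) fun r => (hlt r).le)).not_gt hgt
end

section
/- Assume ω_i > 0 for all i and δ_r > 0 for all r, and let (X0,Y0) ∈ PPS have all components positive. Let F be the set of (U,V,μ0) ∈ ℝ^s × ℝ^m × ℝ with U ≥ 0, V ≥ 0, U^T Y_j − V^T X_j + μ0 ≤ 0 for all j, U^T Y0 − V^T X0 + μ0 = 0, V^T X0 = 1, and assume Σ_r u_r δ_r y_{r0} > 0 for all (U,V,μ0) ∈ F. Let G be the set of (Γ,Λ,τ,μ0′) ∈ ℝ^m × ℝ^s × ℝ × ℝ with Γ ≥ 0, Λ ≥ 0, τ ≥ 0, Σ_r (λ_r/δ_r) y_{rj} − Σ_i (γ_i/ω_i) x_{ij} + μ0′ ≤ 0 for all j, Σ_r (λ_r/δ_r) y_{r0} − Σ_i (γ_i/ω_i) x_{i0} + μ0′ = 0, Σ_i (γ_i/ω_i) x_{i0} = τ,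 and Σ_r λ_r y_{r0} = 1. Then the supremum of (Σ_i v_i ω_i x_{i0})/(Σ_r u_r δ_r y_{r0}) over F equals the supremum of Σ_i γ_i x_{i0} over G, and the infimum over F equals the infimum of Σ_i γ_i x_{i0} over G. -/
open Finset Set

/-- Adjoining `0` to a set of nonnegative reals does not change its supremum. -/
theorem Real.sSup_insert_zero {A : Set ℝ} (hA : ∀ a ∈ A, 0 ≤ a) :
    sSup (insert 0 A) = sSup A := by
  rcases A.eq_empty_or_nonempty with rfl | hne
  · simp
  · by_cases hb : BddAbove A
    · rw [csSup_insert hb hne]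
      exact max_eq_right (Real.sSup_nonneg hA)
    · rw [Real.sSup_of_not_bddAbove hb, Real.sSup_of_not_bddAbove (by simpa using hb)]

/-- Adjoining `0` to a set of nonnegative reals with arbitrarily small elements does not change
its infimum. -/
theorem Real.sInf_insert_zero {A : Set ℝ} (hA : ∀ a ∈ A, 0 ≤ a)
    (hsmall : A.Nonempty → ∀ ε > 0, ∃ a ∈ A, a < ε) :
    sInf (insert 0 A) = sInf A := by
  rcases A.eq_empty_or_nonempty with rfl | hne
  · simp
  · have hb : BddBelow A := ⟨0, hA⟩
    rw [csInf_insert hb hne]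
    refine min_eq_right (le_of_forall_pos_le_add fun ε hε => ?_)
    obtain ⟨a, ha, hlt⟩ := hsmall hne ε hε
    linarith [csInf_le hb ha]

section CharnesCooper

variable {m s n : ℕ} {X : Fin n → Fin m → ℝ} {Y : Fin n → Fin s → ℝ}
  {ω : Fin m → ℝ} {δ : Fin s → ℝ} {X0 : Fin m → ℝ} {Y0 : Fin s → ℝ}

theorem seRatio_nonneg {p : (Fin s → ℝ) × (Fin m → ℝ) × ℝ} (hω : ∀ i, 0 ≤ ω i)
    (hX0 : ∀ i, 0 ≤ X0 i) (hp : p ∈ Fset X Y X0 Y0) (hb : 0 ≤ ∑ r, p.1 r * δ r * Y0 r) :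
    0 ≤ seRatio ω δ X0 Y0 p :=
  div_nonneg (sum_nonneg fun i _ => mul_nonneg (mul_nonneg (hp.2.1 i) (hω i)) (hX0 i)) hb

/-- The Charnes-Cooper transformation maps `Fset` into `Gset`, preserving the objective. -/
theorem exists_mem_Gset_of_mem_Fset (hω : ∀ i, 0 < ω i) (hδ : ∀ r, 0 < δ r)
    {p : (Fin s → ℝ) × (Fin m → ℝ) × ℝ} (hp : p ∈ Fset X Y X0 Y0)
    (hb : 0 < ∑ r, p.1 r * δ r * Y0 r) :
    ∃ q ∈ Gset X Y ω δ X0 Y0, ∑ i, q.1 i * X0 i = seRatio ω δ X0 Y0 p := by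
  obtain ⟨U, V, μ⟩ := p
  obtain ⟨hU, hV, hle, heq, hone⟩ := hp
  dsimp only at hU hV hle heq hone hb
  obtain ⟨τ, hτ⟩ : ∃ τ, τ = (∑ r, U r * δ r * Y0 r)⁻¹ := ⟨_, rfl⟩
  have hτ0 : 0 < τ := hτ ▸ inv_pos.2 hb
  have hu (y : Fin s → ℝ) : ∑ r, τ * (U r * δ r) / δ r * y r = τ * ∑ r, U r * y r := by
    rw [mul_sum]
    refine sum_congr rfl fun r _ => ?_
    have := (hδ r).ne'
    field_simp
  have hv (x : Fin m → ℝ) : ∑ i, τ * (V i * ω i) / ω i * x i = τ * ∑ i, V i * x i := by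
    rw [mul_sum]
    refine sum_congr rfl fun i _ => ?_
    have := (hω i).ne'
    field_simp
  refine ⟨(fun i => τ * (V i * ω i), fun r => τ * (U r * δ r), τ, τ * μ),
    ⟨fun i => mul_nonneg hτ0.le (mul_nonneg (hV i) (hω i).le),
      fun r => mul_nonneg hτ0.le (mul_nonneg (hU r) (hδ r).le), hτ0.le, fun j => ?_, ?_, ?_, ?_⟩,
    ?_⟩ <;> dsimp only
  · rw [hu, hv, ← mul_sub, ← mul_add]
    exact mul_nonpos_of_nonneg_of_nonpos hτ0.le (hle j)
  · rw [hu, hv, ← mul_sub, ← mul_add, heq, mul_zero]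
  · rw [hv, hone, mul_one]
  · simp_rw [mul_assoc τ]
    rw [← mul_sum, hτ, inv_mul_cancel₀ hb.ne']
  · simp_rw [mul_assoc τ]
    rw [← mul_sum, seRatio, hτ, div_eq_inv_mul]

/-- Points of `Gset` with `τ ≠ 0` come from `Fset`. -/
theorem exists_mem_Fset_of_mem_Gset (hω : ∀ i, 0 < ω i) (hδ : ∀ r, 0 < δ r)
    {q : (Fin m → ℝ) × (Fin s → ℝ) × ℝ × ℝ} (hq : q ∈ Gset X Y ω δ X0 Y0) (hne : q.2.2.1 ≠ 0) :
    ∃ p ∈ Fset X Y X0 Y0, seRatio ω δ X0 Y0 p = ∑ i, q.1 i * X0 i := by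
  obtain ⟨Γ, Λ, τ, μ⟩ := q
  obtain ⟨hΓ, hΛ, hτ, hle, heq, hone, hnorm⟩ := hq
  dsimp only at hΓ hΛ hτ hle heq hone hnorm hne
  have hτ' : 0 ≤ τ⁻¹ := inv_nonneg.2 hτ
  have hu (y : Fin s → ℝ) : ∑ r, τ⁻¹ * (Λ r / δ r) * y r = τ⁻¹ * ∑ r, Λ r / δ r * y r := by
    simp_rw [mul_sum, mul_assoc]
  have hv (x : Fin m → ℝ) : ∑ i, τ⁻¹ * (Γ i / ω i) * x i = τ⁻¹ * ∑ i, Γ i / ω i * x i := by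
    simp_rw [mul_sum, mul_assoc]
  refine ⟨(fun r => τ⁻¹ * (Λ r / δ r), fun i => τ⁻¹ * (Γ i / ω i), τ⁻¹ * μ),
    ⟨fun r => mul_nonneg hτ' (div_nonneg (hΛ r) (hδ r).le),
      fun i => mul_nonneg hτ' (div_nonneg (hΓ i) (hω i).le), fun j => ?_, ?_, ?_⟩, ?_⟩ <;>
    dsimp only
  · rw [hu, hv, ← mul_sub, ← mul_add]
    exact mul_nonpos_of_nonneg_of_nonpos hτ' (hle j)
  · rw [hu, hv, ← mul_sub, ← mul_add, heq, mul_zero]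
  · rw [hv, hone, inv_mul_cancel₀ hne]
  · have h1 (i : Fin m) : τ⁻¹ * (Γ i / ω i) * ω i * X0 i = τ⁻¹ * (Γ i * X0 i) := by
      have := (hω i).ne'
      field_simp
    have h2 (r : Fin s) : τ⁻¹ * (Λ r / δ r) * δ r * Y0 r = τ⁻¹ * (Λ r * Y0 r) := by
      have := (hδ r).ne'
      field_simp
    simp only [seRatio, h1, h2]
    rw [← mul_sum, ← mul_sum, hnorm, mul_one, mul_div_cancel_left₀ _ (inv_ne_zero hne)]

/-- Points of `Gset` with `τ = 0` have vanishing input multipliers. -/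
theorem fst_eq_zero_of_mem_Gset (hω : ∀ i, 0 < ω i) (hX0 : ∀ i, 0 < X0 i)
    {q : (Fin m → ℝ) × (Fin s → ℝ) × ℝ × ℝ} (hq : q ∈ Gset X Y ω δ X0 Y0) (h0 : q.2.2.1 = 0) :
    q.1 = 0 := by
  obtain ⟨hΓ, -, -, -, -, hone, -⟩ := hq
  rw [h0, sum_eq_zero_iff_of_nonneg fun i _ =>
    mul_nonneg (div_nonneg (hΓ i) (hω i).le) (hX0 i).le] at hone
  funext i
  simpa [(hω i).ne', (hX0 i).ne'] using hone i (mem_univ i)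

/-- A point of `Gset` with `τ = 0` is a recession direction of `Fset` along which the objective
tends to `0`. -/
theorem exists_seRatio_lt_of_mem_Gset (hω : ∀ i, 0 < ω i) (hδ : ∀ r, 0 < δ r)
    (hX0 : ∀ i, 0 < X0 i) {q : (Fin m → ℝ) × (Fin s → ℝ) × ℝ × ℝ}
    (hq : q ∈ Gset X Y ω δ X0 Y0) (h0 : q.2.2.1 = 0)
    {p : (Fin s → ℝ) × (Fin m → ℝ) × ℝ} (hp : p ∈ Fset X Y X0 Y0)
    (hb : 0 < ∑ r, p.1 r * δ r * Y0 r) {ε : ℝ} (hε : 0 < ε) :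
    ∃ p' ∈ Fset X Y X0 Y0, seRatio ω δ X0 Y0 p' < ε := by
  have hΓ0 := fst_eq_zero_of_mem_Gset hω hX0 hq h0
  obtain ⟨Γ, Λ, τ, ν⟩ := q
  obtain ⟨U, V, μ⟩ := p
  obtain ⟨-, hΛ, -, hle, heq, -, hnorm⟩ := hq
  obtain ⟨hU, hV, hle', heq', hone'⟩ := hp
  dsimp only at hΓ0 hΛ hle heq hnorm hU hV hle' heq' hone' hb
  subst hΓ0
  simp only [Pi.zero_apply, zero_div, zero_mul, sum_const_zero, sub_zero] at hle heq
  obtain ⟨a, ha⟩ : ∃ a, a = ∑ i, V i * ω i * X0 i := ⟨_, rfl⟩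
  have ha0 : 0 ≤ a := ha ▸ sum_nonneg fun i _ =>
    mul_nonneg (mul_nonneg (hV i) (hω i).le) (hX0 i).le
  obtain ⟨k, hk⟩ : ∃ k, k = a / ε := ⟨_, rfl⟩
  have hk0 : 0 ≤ k := hk ▸ div_nonneg ha0 hε.le
  have hu (y : Fin s → ℝ) : ∑ r, (U r + k * (Λ r / δ r)) * y r =
      ∑ r, U r * y r + k * ∑ r, Λ r / δ r * y r := by
    rw [mul_sum, ← sum_add_distrib]
    exact sum_congr rfl fun r _ => by ring
  refine ⟨(fun r => U r + k * (Λ r / δ r), V, μ + k * ν),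
    ⟨fun r => add_nonneg (hU r) (mul_nonneg hk0 (div_nonneg (hΛ r) (hδ r).le)), hV,
      fun j => ?_, ?_, hone'⟩, ?_⟩
  · dsimp only
    rw [hu]
    linarith [hle' j, mul_nonpos_of_nonneg_of_nonpos hk0 (hle j)]
  · dsimp only
    rw [hu]
    linear_combination heq' + k * heq
  · have hden : ∑ r, (U r + k * (Λ r / δ r)) * δ r * Y0 r = ∑ r, U r * δ r * Y0 r + k := by
      trans ∑ r, U r * δ r * Y0 r + k * ∑ r, Λ r * Y0 r
      · rw [mul_sum, ← sum_add_distrib]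
        refine sum_congr rfl fun r _ => ?_
        have := (hδ r).ne'
        field_simp
      · rw [hnorm, mul_one]
    simp only [seRatio]
    rw [hden, ← ha, div_lt_iff₀ (by linarith), mul_add, hk, mul_div_cancel₀ _ hε.ne']
    linarith [mul_pos hε hb]

end CharnesCooper

/-- Charnes-Cooper transformation: the fractional program (Model 28) over F and the
linear program (Model 33) over G have the same optimal values (sup and inf). -/
theorem charnes_cooper_equivalence
    {m s n : ℕ} (hm : 1 ≤ m) (hs : 1 ≤ s) (hn : 1 ≤ n)
    (X : Fin n → Fin m → ℝ) (Y : Fin n → Fin s → ℝ)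
    (hX : ∀ j i, 0 < X j i) (hY : ∀ j r, 0 < Y j r)
    (ω : Fin m → ℝ) (δ : Fin s → ℝ)
    (hω : ∀ i, 0 ≤ ω i) (hδ : ∀ r, 0 ≤ δ r)
    (hωsum : (∑ i, ω i) = (m : ℝ)) (hδsum : (∑ r, δ r) = (s : ℝ))
    (X0 : Fin m → ℝ) (Y0 : Fin s → ℝ)
    (hX0 : ∀ i, 0 < X0 i) (hY0 : ∀ r, 0 < Y0 r)
    (hωpos : ∀ i, 0 < ω i) (hδpos : ∀ r, 0 < δ r)
    (hp : (X0, Y0) ∈ PPS X Y)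
    (hpos : ∀ p ∈ Fset X Y X0 Y0, 0 < ∑ r, p.1 r * δ r * Y0 r) :
    sSup (seRatio ω δ X0 Y0 '' Fset X Y X0 Y0) =
      sSup ((fun q : (Fin m → ℝ) × (Fin s → ℝ) × ℝ × ℝ => ∑ i, q.1 i * X0 i) ''
        Gset X Y ω δ X0 Y0) ∧
    sInf (seRatio ω δ X0 Y0 '' Fset X Y X0 Y0) =
      sInf ((fun q : (Fin m → ℝ) × (Fin s → ℝ) × ℝ × ℝ => ∑ i, q.1 i * X0 i) ''
        Gset X Y ω δ X0 Y0) := by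
  have hsub : seRatio ω δ X0 Y0 '' Fset X Y X0 Y0 ⊆
      (fun q : (Fin m → ℝ) × (Fin s → ℝ) × ℝ × ℝ => ∑ i, q.1 i * X0 i) '' Gset X Y ω δ X0 Y0 := by
    rintro _ ⟨p, hpF, rfl⟩
    exact exists_mem_Gset_of_mem_Fset hωpos hδpos hpF (hpos p hpF)
  have hnonneg : ∀ a ∈ seRatio ω δ X0 Y0 '' Fset X Y X0 Y0, 0 ≤ a := by
    rintro _ ⟨p, hpF, rfl⟩
    exact seRatio_nonneg hω (fun i => (hX0 i).le) hpF (hpos p hpF).le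
  by_cases h : ∃ q ∈ Gset X Y ω δ X0 Y0, q.2.2.1 = 0
  · obtain ⟨q₀, hq₀, hτ₀⟩ := h
    have himage : (fun q : (Fin m → ℝ) × (Fin s → ℝ) × ℝ × ℝ => ∑ i, q.1 i * X0 i) ''
        Gset X Y ω δ X0 Y0 = insert 0 (seRatio ω δ X0 Y0 '' Fset X Y X0 Y0) := by
      refine Subset.antisymm ?_ (insert_subset ⟨q₀, hq₀, ?_⟩ hsub)
      · rintro _ ⟨q, hq, rfl⟩
        by_cases hτ : q.2.2.1 = 0
        · left
          simp [fst_eq_zero_of_mem_Gset hωpos hX0 hq hτ]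
        · exact Or.inr (exists_mem_Fset_of_mem_Gset hωpos hδpos hq hτ)
      · simp [fst_eq_zero_of_mem_Gset hωpos hX0 hq₀ hτ₀]
    rw [himage, Real.sSup_insert_zero hnonneg, Real.sInf_insert_zero hnonneg]
    · exact ⟨rfl, rfl⟩
    · rintro ⟨_, p, hpF, rfl⟩ ε hε
      obtain ⟨p', hp', hlt⟩ :=
        exists_seRatio_lt_of_mem_Gset hωpos hδpos hX0 hq₀ hτ₀ hpF (hpos p hpF) hε
      exact ⟨_, ⟨p', hp', rfl⟩, hlt⟩
  · push Not at h
    have himage := Subset.antisymm hsub (by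
      rintro _ ⟨q, hq, rfl⟩
      exact exists_mem_Fset_of_mem_Gset hωpos hδpos hq (h q hq))
    rw [himage]
    exact ⟨rfl, rfl⟩
end
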